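/- Let n ≥ 3 be an even integer, n − 1 < β < α ≤ ⌈α⌉ = n, a > 0, and let f : ℝ → ℝ, q : [0,∞) → ℝ, g : [0,∞) → ℝ be continuous satisfying: (G1) x·f(x) > 0 for all x ≠ 0; (G2) there exist c_1, η > 0 with |f(x)| ≥ c_1|x|^η for all |x| ≥ 1; (G3) there exist c_2 > 0 and μ ∈ (0, (n−2)/(n−β)) with |f(x)| ≥ c_2|x|^μ for all |x| < 1; (H) there exist T_1 > 0 and c_3 > 0 with q(t) ≥ c_3 for all t ≥ T_1; (K) there exist σ ∈ (n−β, 1), c_4 > 0 and T_2 > 0 with g(t) ≥ c_4 t^{n−β−σ} for all t ≥ T_2. Let x be a non-oscillatory solution of (^C D^α_{0^+} x)(t) + a·(^C D^β_{0^+} x)(t) + q(t)·f(x(t)) + sgn(x(t))·g(t) = 0, t > 0, with initial conditions x(0) = x_0, x^{(i)}(0) = x_i for i = 1,…,n−1. Then x(t) = O(t^{α−n}) as t → ∞. -/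

import Mathlib

open MeasureTheory Filter Set

noncomputable def fracInt (γ : ℝ) (f : ℝ → ℝ) (t : ℝ) : ℝ :=
  (1 / Real.Gamma γ) * ∫ s in (0:ℝ)..t, (t - s) ^ (γ - 1) * f s

noncomputable def taylorPolyAt0 (n : ℕ) (f : ℝ → ℝ) (t : ℝ) : ℝ :=
  ∑ k ∈ Finset.range n, iteratedDeriv k f 0 / (Nat.factorial k : ℝ) * t ^ k

noncomputable def caputoD (γ : ℝ) (f : ℝ → ℝ) : ℝ → ℝ :=
  iteratedDeriv ⌈γ⌉₊
    (fun t => fracInt ((⌈γ⌉₊ : ℝ) - γ) (fun s => f s - taylorPolyAt0 ⌈γ⌉₊ f s) t)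

def ContCaputoDiffOnIci (γ : ℝ) (f : ℝ → ℝ) : Prop :=
  ContDiffOn ℝ (⌈γ⌉₊ - 1 : ℕ) f (Set.Ici 0) ∧ ContinuousOn (caputoD γ f) (Set.Ici 0)

def Oscillatory (x : ℝ → ℝ) : Prop :=
  ∃ u : ℕ → ℝ, (∀ n, 0 ≤ u n) ∧ Filter.Tendsto u Filter.atTop Filter.atTop ∧ ∀ n, x (u n) = 0

section FractionalIntegral

lemma intervalIntegrable_sub_rpow {b : ℝ} (hb : 0 < b) (t u v : ℝ) :
    IntervalIntegrable (fun s => (t - s) ^ (b - 1)) volume u v := by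
  have h := (intervalIntegral.intervalIntegrable_rpow' (a := t - u) (b := t - v)
    (r := b - 1) (by linarith)).comp_sub_left t
  simpa using h

lemma intervalIntegrable_sub_rpow_mul {b t : ℝ} (hb : 0 < b) (ht : 0 ≤ t) {F : ℝ → ℝ}
    (hF : ContinuousOn F (Icc 0 t)) :
    IntervalIntegrable (fun s => (t - s) ^ (b - 1) * F s) volume 0 t :=
  (intervalIntegrable_sub_rpow hb t 0 t).mul_continuousOn (by rwa [uIcc_of_le ht])

lemma fracInt_congr {b t : ℝ} (ht : 0 ≤ t) {F G : ℝ → ℝ} (h : EqOn F G (Icc 0 t)) :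
    fracInt b F t = fracInt b G t := by
  unfold fracInt
  congr 1
  refine intervalIntegral.integral_congr fun s hs => ?_
  rw [uIcc_of_le ht] at hs
  simp only [h hs]

lemma fracInt_add {b t : ℝ} (hb : 0 < b) (ht : 0 ≤ t) {F G : ℝ → ℝ}
    (hF : ContinuousOn F (Icc 0 t)) (hG : ContinuousOn G (Icc 0 t)) :
    fracInt b (fun s => F s + G s) t = fracInt b F t + fracInt b G t := by
  unfold fracInt
  rw [← mul_add, ← intervalIntegral.integral_add (intervalIntegrable_sub_rpow_mul hb ht hF)
    (intervalIntegrable_sub_rpow_mul hb ht hG)]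
  simp only [mul_add]

lemma fracInt_neg (b : ℝ) (F : ℝ → ℝ) (t : ℝ) :
    fracInt b (fun s => -F s) t = -fracInt b F t := by
  simp [fracInt]

lemma fracInt_const_mul (b c : ℝ) (F : ℝ → ℝ) (t : ℝ) :
    fracInt b (fun s => c * F s) t = c * fracInt b F t := by
  unfold fracInt
  simp only [mul_left_comm _ c, intervalIntegral.integral_const_mul]

lemma fracInt_sub {b t : ℝ} (hb : 0 < b) (ht : 0 ≤ t) {F G : ℝ → ℝ}
    (hF : ContinuousOn F (Icc 0 t)) (hG : ContinuousOn G (Icc 0 t)) :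
    fracInt b (fun s => F s - G s) t = fracInt b F t - fracInt b G t := by
  simp only [sub_eq_add_neg, ← fracInt_neg]
  exact fracInt_add hb ht hF hG.neg

lemma fracInt_mono {b t : ℝ} (hb : 0 < b) (ht : 0 ≤ t) {F G : ℝ → ℝ}
    (hF : ContinuousOn F (Icc 0 t)) (hG : ContinuousOn G (Icc 0 t))
    (h : ∀ s ∈ Icc 0 t, F s ≤ G s) :
    fracInt b F t ≤ fracInt b G t := by
  unfold fracInt
  refine mul_le_mul_of_nonneg_left ?_ (by have := Real.Gamma_pos_of_pos hb; positivity)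
  refine intervalIntegral.integral_mono_on ht (intervalIntegrable_sub_rpow_mul hb ht hF)
    (intervalIntegrable_sub_rpow_mul hb ht hG) fun s hs => ?_
  exact mul_le_mul_of_nonneg_left (h s hs) (Real.rpow_nonneg (by linarith [hs.2]) _)

lemma fracInt_const {b t : ℝ} (hb : 0 < b) (c : ℝ) :
    fracInt b (fun _ => c) t = c * (t ^ b / (b * Real.Gamma b)) := by
  unfold fracInt
  have h := intervalIntegral.integral_comp_sub_left (a := 0) (b := t)
    (fun s : ℝ => s ^ (b - 1)) t
  rw [intervalIntegral.integral_mul_const, h, sub_self, sub_zero,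
    integral_rpow (Or.inl (by linarith))]
  rw [sub_add_cancel, Real.zero_rpow hb.ne', sub_zero]
  field_simp

lemma fracInt_one (F : ℝ → ℝ) (t : ℝ) : fracInt 1 F t = ∫ s in (0:ℝ)..t, F s := by
  simp [fracInt]

lemma fracInt_of_nonpos {b t : ℝ} {F : ℝ → ℝ} (hF : ∀ s ≤ 0, F s = 0) (ht : t ≤ 0) :
    fracInt b F t = 0 := by
  unfold fracInt
  rw [intervalIntegral.integral_congr (g := fun _ => (0 : ℝ))]
  · simp
  · intro s hs
    rw [uIcc_of_ge ht] at hs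
    simp [hF s hs.2]

lemma fracInt_eq_reflect {b t N : ℝ} {F : ℝ → ℝ} (hF : ∀ s ≤ 0, F s = 0) (hN : 0 ≤ N)
    (htN : t ≤ N) :
    fracInt b F t = (1 / Real.Gamma b) * ∫ r in (0:ℝ)..N, r ^ (b - 1) * F (t - r) := by
  have hz : ∀ u v : ℝ, t ≤ u → t ≤ v →
      ∫ r in u..v, r ^ (b - 1) * F (t - r) = 0 := by
    intro u v hu hv
    rw [intervalIntegral.integral_congr (g := fun _ => (0 : ℝ))]
    · simp
    · intro r hr
      have : t ≤ r := le_trans (le_min hu hv) hr.1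
      simp [hF (t - r) (by linarith)]
  rcases le_total t 0 with ht | ht
  · rw [fracInt_of_nonpos hF ht, hz 0 N ht htN, mul_zero]
  · unfold fracInt
    congr 1
    have h := intervalIntegral.integral_comp_sub_left (a := 0) (b := t)
      (fun s : ℝ => s ^ (b - 1) * F (t - s)) t
    simp only [sub_sub_cancel, sub_self, sub_zero] at h
    rw [h]
    have hE : EqOn (fun r => r ^ (b - 1) * F (t - r)) (fun _ => (0:ℝ)) (Icc t N) := by
      intro r hr
      simp [hF (t - r) (by linarith [hr.1])]
    by_cases hi : IntervalIntegrable (fun r => r ^ (b - 1) * F (t - r)) volume 0 t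
    · rw [← intervalIntegral.integral_add_adjacent_intervals hi
        (b := t) (c := N), hz t N le_rfl htN, add_zero]
      refine (intervalIntegrable_congr ?_).2 (intervalIntegrable_const (c := (0:ℝ)))
      intro r hr
      rw [uIoc_of_le htN] at hr
      exact hE ⟨hr.1.le, hr.2⟩
    · rw [intervalIntegral.integral_undef hi, intervalIntegral.integral_undef]
      intro h'
      exact hi (h'.mono_set (by rw [uIcc_of_le ht, uIcc_of_le hN]; exact Icc_subset_Icc_right htN))

/-- The Riemann–Liouville kernel, truncated to `(0, N]`. -/
noncomputable def rlKernel (b N : ℝ) : ℝ → ℝ :=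
  indicator (Ioc 0 N) fun s => 1 / Real.Gamma b * s ^ (b - 1)

lemma integrable_rlKernel {b N : ℝ} (hb : 0 < b) (hN : 0 ≤ N) : Integrable (rlKernel b N) := by
  unfold rlKernel
  rw [integrable_indicator_iff measurableSet_Ioc]
  have := (intervalIntegral.intervalIntegrable_rpow' (a := 0) (b := N)
    (r := b - 1) (by linarith)).const_mul (1 / Real.Gamma b)
  rwa [intervalIntegrable_iff_integrableOn_Ioc_of_le hN] at this

open scoped Convolution in
lemma fracInt_eq_convolution {b t N : ℝ} {F : ℝ → ℝ} (hF : ∀ s ≤ 0, F s = 0) (hN : 0 ≤ N)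
    (htN : t ≤ N) :
    fracInt b F t = (rlKernel b N ⋆[ContinuousLinearMap.mul ℝ ℝ, volume] F) t := by
  rw [fracInt_eq_reflect hF hN htN, convolution, ← intervalIntegral.integral_const_mul,
    intervalIntegral.integral_of_le hN, ← integral_indicator measurableSet_Ioc]
  congr 1
  ext s
  by_cases hs : s ∈ Ioc 0 N
  · simp [rlKernel, hs, mul_assoc]
  · simp [rlKernel, hs]

lemma integral_rpow_mul_sub_rpow {a b x : ℝ} (ha : 0 < a) (hb : 0 < b) (hx : 0 < x) :
    ∫ s in (0:ℝ)..x, s ^ (a - 1) * (x - s) ^ (b - 1)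
      = Real.Gamma a * Real.Gamma b / Real.Gamma (a + b) * x ^ (a + b - 1) := by
  have h := Complex.betaIntegral_scaled a b hx
  have hB := Complex.Gamma_mul_Gamma_eq_betaIntegral (s := a) (t := b) (by simpa) (by simpa)
  have hg : (Real.Gamma (a + b) : ℂ) ≠ 0 := by
    exact_mod_cast (Real.Gamma_pos_of_pos (add_pos ha hb)).ne'
  have hB' : Complex.betaIntegral a b
      = ((Real.Gamma a * Real.Gamma b / Real.Gamma (a + b) : ℝ) : ℂ) := by
    rw [← Complex.ofReal_add] at hB
    simp only [Complex.Gamma_ofReal] at hB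
    push_cast
    rw [hB]
    field_simp
  have hI : ∫ s in (0:ℝ)..x, (s : ℂ) ^ ((a : ℂ) - 1) * ((x : ℂ) - s) ^ ((b : ℂ) - 1)
      = ((∫ s in (0:ℝ)..x, s ^ (a - 1) * (x - s) ^ (b - 1) : ℝ) : ℂ) := by
    rw [← intervalIntegral.integral_ofReal]
    refine intervalIntegral.integral_congr fun s hs => ?_
    rw [uIcc_of_le hx.le] at hs
    rw [Complex.ofReal_mul, Complex.ofReal_cpow hs.1, Complex.ofReal_cpow (by linarith [hs.2])]
    push_cast
    rfl
  rw [hI, hB', show ((a:ℂ) + b - 1) = ((a + b - 1 : ℝ) : ℂ) by push_cast; ring,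
    ← Complex.ofReal_cpow hx.le, ← Complex.ofReal_mul] at h
  rw [Complex.ofReal_injective h, mul_comm]

open scoped Convolution in
lemma rlKernel_convolution {a b x N : ℝ} (ha : 0 < a) (hb : 0 < b) (hxN : x ≤ N) :
    (rlKernel a N ⋆[ContinuousLinearMap.mul ℝ ℝ, volume] rlKernel b N) x
      = rlKernel (a + b) N x := by
  rcases le_or_gt x 0 with hx | hx
  · rw [convolution, show rlKernel (a + b) N x = 0 from
      indicator_of_notMem (fun h => hx.not_gt h.1) _, integral_eq_zero_of_ae]
    refine Filter.Eventually.of_forall fun s => ?_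
    by_cases hs : s ∈ Ioc 0 N
    · have : x - s ∉ Ioc 0 N := fun h => by linarith [h.1, hs.1]
      simp [rlKernel, this]
    · simp [rlKernel, hs]
  · have hpos : ∀ c : ℝ, 0 < c → 0 < Real.Gamma c := fun c => Real.Gamma_pos_of_pos
    rw [convolution]
    have : (fun t => (ContinuousLinearMap.mul ℝ ℝ) (rlKernel a N t) (rlKernel b N (x - t)))
        = indicator (Ioo 0 x) fun s =>
          (1 / Real.Gamma a * (1 / Real.Gamma b)) * (s ^ (a - 1) * (x - s) ^ (b - 1)) := by
      ext s
      by_cases hs : s ∈ Ioo 0 x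
      · have h1 : s ∈ Ioc 0 N := ⟨hs.1, by linarith [hs.2]⟩
        have h2 : x - s ∈ Ioc 0 N := ⟨by linarith [hs.2], by linarith [hs.1]⟩
        simp only [ContinuousLinearMap.mul_apply', rlKernel, indicator_of_mem h1,
          indicator_of_mem h2, indicator_of_mem hs]
        ring
      · rw [indicator_of_notMem hs]
        by_cases h1 : s ∈ Ioc 0 N
        · have h2 : x - s ∉ Ioc 0 N := fun h => hs ⟨h1.1, by linarith [h.1]⟩
          simp [rlKernel, h2]
        · simp [rlKernel, h1]
    rw [this, integral_indicator measurableSet_Ioo, ← integral_Ioc_eq_integral_Ioo,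
      ← intervalIntegral.integral_of_le hx.le, intervalIntegral.integral_const_mul,
      integral_rpow_mul_sub_rpow ha hb hx,
      show rlKernel (a + b) N x = _ from indicator_of_mem (show x ∈ Ioc 0 N from ⟨hx, hxN⟩) _]
    have := hpos a ha
    have := hpos b hb
    have := hpos (a + b) (add_pos ha hb)
    field_simp

lemma exists_bound_comp_min {F : ℝ → ℝ} (hc : Continuous F) (hF : ∀ s ≤ 0, F s = 0) (N : ℝ) :
    ∃ C, ∀ s, |F (min s N)| ≤ C := by
  obtain ⟨C, hC⟩ := (isCompact_Icc (a := (0:ℝ)) (b := N)).exists_bound_of_continuousOn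
    hc.continuousOn
  refine ⟨max C 0, fun s => ?_⟩
  rcases le_total (min s N) 0 with h | h
  · simp [hF _ h]
  · exact (hC _ ⟨h, min_le_right _ _⟩).trans (le_max_left _ _)

open scoped Convolution in
lemma fracInt_fracInt {a b : ℝ} (ha : 0 < a) (hb : 0 < b) {F : ℝ → ℝ} (hc : Continuous F)
    (hF : ∀ s ≤ 0, F s = 0) (t : ℝ) :
    fracInt a (fracInt b F) t = fracInt (a + b) F t := by
  rcases le_total t 0 with ht | ht
  · rw [fracInt_of_nonpos hF ht, fracInt_of_nonpos (fun s hs => fracInt_of_nonpos hF hs) ht]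
  set k : ℝ → ℝ := fun s => F (min s t) with hk
  have hkc : Continuous k := by fun_prop
  have hk0 : ∀ s ≤ 0, k s = 0 := fun s hs => hF _ (le_trans (min_le_left _ _) hs)
  have hFk : EqOn F k (Icc 0 t) := fun s hs => by simp [hk, min_eq_left hs.2]
  obtain ⟨C, hC⟩ := exists_bound_comp_min hc hF t
  have e1 : fracInt a (fracInt b F) t = fracInt a (fracInt b k) t := by
    refine fracInt_congr ht fun s hs => fracInt_congr hs.1 fun r hr => ?_
    exact hFk ⟨hr.1, hr.2.trans hs.2⟩
  have hka := integrable_rlKernel ha ht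
  have hkb := integrable_rlKernel hb ht
  let L := ContinuousLinearMap.mul ℝ ℝ
  have e2 : fracInt a (fracInt b k) t
      = (rlKernel a t ⋆[L, volume] (rlKernel b t ⋆[L, volume] k)) t := by
    rw [fracInt_eq_convolution (fun s hs => fracInt_of_nonpos hk0 hs) ht le_rfl,
      convolution, convolution]
    congr 1
    ext s
    by_cases hs : s ∈ Ioc 0 t
    · rw [fracInt_eq_convolution hk0 ht (by linarith [hs.1])]
    · simp [rlKernel, hs, L]
  have e3 : fracInt (a + b) k t
      = ((rlKernel a t ⋆[L, volume] rlKernel b t) ⋆[L, volume] k) t := by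
    rw [fracInt_eq_convolution hk0 ht le_rfl, convolution, convolution]
    congr 1
    ext s
    rcases le_or_gt s t with hs | hs
    · rw [rlKernel_convolution ha hb hs]
    · simp [hk0 (t - s) (by linarith)]
  rw [e1, e2, fracInt_congr ht hFk, e3]
  refine (convolution_assoc' L L L L (fun x y z => by simp [L, mul_assoc]) ?_ ?_ ?_).symm
  · exact hka.ae_convolution_exists L hkb
  · refine Filter.Eventually.of_forall fun x => ?_
    exact hkb.mul_bdd (c := C) (by fun_prop) (Filter.Eventually.of_forall fun s => hC _)
  · have h := hka.convolution_integrand L hkb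
    have h2 := h.mul_bdd (c := C) (g := fun p : ℝ × ℝ => k (t - p.1))
      (Continuous.aestronglyMeasurable (by fun_prop))
      (Filter.Eventually.of_forall fun s => hC _)
    refine h2.congr (Filter.Eventually.of_forall fun p => ?_)
    simp [L, Function.uncurry, mul_assoc]

lemma continuous_fracInt {b : ℝ} (hb : 0 < b) {F : ℝ → ℝ} (hc : Continuous F)
    (hF : ∀ s ≤ 0, F s = 0) : Continuous (fracInt b F) := by
  rw [continuous_iff_continuousAt]
  intro t₀
  set N := |t₀| + 1 with hN
  have hN0 : 0 ≤ N := by positivity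
  have htN : t₀ < N := by have := le_abs_self t₀; linarith
  obtain ⟨C, hC⟩ := exists_bound_comp_min hc hF N
  have hcont : Continuous fun t =>
      (1 / Real.Gamma b) * ∫ r in (0:ℝ)..N, r ^ (b - 1) * F (min (t - r) N) := by
    refine continuous_const.mul ?_
    refine intervalIntegral.continuous_of_dominated_interval
      (bound := fun r => |r ^ (b - 1)| * C) ?_ ?_ ?_ ?_
    · intro t
      refine AEStronglyMeasurable.mul ?_ (Continuous.aestronglyMeasurable (by fun_prop))
      exact (measurable_id.pow_const _).aestronglyMeasurable
    · intro t
      refine Filter.Eventually.of_forall fun r _ => ?_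
      rw [norm_mul]
      exact mul_le_mul_of_nonneg_left (hC _) (abs_nonneg _)
    · exact ((intervalIntegral.intervalIntegrable_rpow' (by linarith)).abs).mul_const C
    · exact Filter.Eventually.of_forall fun r _ => by fun_prop
  refine hcont.continuousAt.congr ?_
  filter_upwards [gt_mem_nhds htN] with t ht
  rw [fracInt_eq_reflect hF hN0 ht.le]
  congr 1
  refine intervalIntegral.integral_congr fun r hr => ?_
  rw [uIcc_of_le hN0] at hr
  simp only [min_eq_left (show t - r ≤ N by linarith [hr.1])]

lemma hasDerivAt_integral_zero {F : ℝ → ℝ} (hc : Continuous F) (t : ℝ) :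
    HasDerivAt (fun t => ∫ s in (0:ℝ)..t, F s) (F t) t :=
  intervalIntegral.integral_hasDerivAt_right (hc.intervalIntegrable _ _)
    hc.stronglyMeasurable.stronglyMeasurableAtFilter hc.continuousAt

lemma hasDerivAt_fracInt {b : ℝ} (hb : 0 < b) {F F' : ℝ → ℝ} (hd : ∀ t, HasDerivAt F (F' t) t)
    (hc : Continuous F') (hF : ∀ s ≤ 0, F s = 0) (hF' : ∀ s ≤ 0, F' s = 0) (t : ℝ) :
    HasDerivAt (fracInt b F) (fracInt b F' t) t := by
  have h1 : F = fracInt 1 F' := by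
    ext t
    rw [fracInt_one, intervalIntegral.integral_eq_sub_of_hasDerivAt (fun s _ => hd s)
      (hc.intervalIntegrable _ _), hF 0 le_rfl, sub_zero]
  have h2 : fracInt b F = fun t => ∫ s in (0:ℝ)..t, fracInt b F' s := by
    ext t
    rw [h1, fracInt_fracInt hb one_pos hc hF', ← fracInt_one,
      fracInt_fracInt one_pos hb hc hF', add_comm]
  rw [h2]
  exact hasDerivAt_integral_zero (continuous_fracInt hb hc hF') t

end FractionalIntegral

section History

/-- The contribution of the time window `[0, c]` to a fractional integral. -/
noncomputable def history (p c : ℝ) (φ : ℝ → ℝ) (t : ℝ) : ℝ :=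
  ∫ s in (0:ℝ)..c, (t - s) ^ p * φ s

lemma hasDerivAt_history {p c t : ℝ} {φ : ℝ → ℝ} (hc : 0 ≤ c) (hφ : ContinuousOn φ (Icc 0 c))
    (ht : c < t) : HasDerivAt (history p c φ) (p * history (p - 1) c φ t) t := by
  have hcont : ∀ q : ℝ, ∀ x > c, ContinuousOn (fun s => (x - s) ^ q * φ s) (Icc 0 c) := by
    intro q x hx
    refine ContinuousOn.mul (ContinuousOn.rpow_const (by fun_prop) ?_) hφ
    intro s hs
    exact Or.inl (by linarith [hs.2])
  have hsub : uIoc 0 c ⊆ Icc 0 c := by rw [uIoc_of_le hc]; exact Ioc_subset_Icc_self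
  have hmeas : ∀ q : ℝ, ∀ x > c,
      AEStronglyMeasurable (fun s => (x - s) ^ q * φ s) (volume.restrict (uIoc 0 c)) := by
    intro q x hx
    exact ((hcont q x hx).mono hsub).aestronglyMeasurable measurableSet_uIoc
  have hK : IsCompact (Icc ((c + t) / 2) (t + 1) ×ˢ Icc 0 c) := isCompact_Icc.prod isCompact_Icc
  obtain ⟨C, hC⟩ := hK.exists_bound_of_continuousOn
    (f := fun z : ℝ × ℝ => p * (z.1 - z.2) ^ (p - 1) * φ z.2) (by
      refine ContinuousOn.mul (ContinuousOn.mul continuousOn_const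
        (ContinuousOn.rpow_const (by fun_prop) ?_)) (hφ.comp continuousOn_snd fun z hz => hz.2)
      rintro ⟨x, s⟩ ⟨hx, hs⟩
      have h1 := hs.2
      have h2 := hx.1
      simp only at h1 h2 ⊢
      exact Or.inl (by linarith))
  have key := (intervalIntegral.hasDerivAt_integral_of_dominated_loc_of_deriv_le
    (μ := volume) (a := 0) (b := c)
    (F := fun x s => (x - s) ^ p * φ s) (F' := fun x s => p * (x - s) ^ (p - 1) * φ s)
    (x₀ := t) (s := Icc ((c + t) / 2) (t + 1)) (bound := fun _ => C)
    (Icc_mem_nhds (by linarith) (by linarith)) ?_ ?_ ?_ ?_ ?_ ?_).2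
  · unfold history
    rw [← intervalIntegral.integral_const_mul]
    simpa only [mul_assoc] using key
  · filter_upwards [lt_mem_nhds ht] with x hx using hmeas p x hx
  · refine ContinuousOn.intervalIntegrable ?_
    rw [uIcc_of_le hc]
    exact hcont p t ht
  · simpa only [mul_assoc] using (hmeas (p - 1) t ht).const_mul p
  · exact Filter.Eventually.of_forall fun s hs x hx => hC (x, s) ⟨hx, hsub hs⟩
  · exact intervalIntegrable_const
  · refine Filter.Eventually.of_forall fun s hs x hx => ?_
    have hxs : x - s ≠ 0 := by
      have := (hsub hs).2
      have := hx.1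
      linarith
    have h := ((hasDerivAt_id x).sub_const s).rpow_const (p := p) (Or.inl hxs)
    simpa using h.mul_const (φ s)

lemma continuousOn_history {p c : ℝ} {φ : ℝ → ℝ} (hc : 0 ≤ c) (hφ : ContinuousOn φ (Icc 0 c)) :
    ContinuousOn (history p c φ) (Ioi c) := fun _ ht =>
  (hasDerivAt_history hc hφ ht).continuousAt.continuousWithinAt

lemma exists_history_bound {p c : ℝ} {φ : ℝ → ℝ} (hp : p ≤ -1) (hc : 0 ≤ c)
    (hφ : ContinuousOn φ (Icc 0 c)) :
    ∃ C, 0 ≤ C ∧ ∀ t ≥ 2 * c + 2, |history p c φ t| ≤ C / t := by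
  obtain ⟨C, hC⟩ := isCompact_Icc.exists_bound_of_continuousOn hφ
  have hC0 : 0 ≤ C := (norm_nonneg _).trans (hC 0 ⟨le_rfl, hc⟩)
  refine ⟨2 * C * c, by positivity, fun t ht => ?_⟩
  have ht0 : 0 < t := by linarith
  have h : ‖history p c φ t‖ ≤ (2 / t * C) * |c - 0| := by
    refine intervalIntegral.norm_integral_le_of_norm_le_const fun s hs => ?_
    rw [uIoc_of_le hc] at hs
    rw [norm_mul]
    refine mul_le_mul ?_ (hC s ⟨hs.1.le, hs.2⟩) (norm_nonneg _) (by positivity)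
    have h1 : 1 ≤ t - s := by linarith [hs.2]
    rw [Real.norm_of_nonneg (by positivity)]
    calc (t - s) ^ p ≤ (t - s) ^ (-1 : ℝ) := Real.rpow_le_rpow_of_exponent_le h1 hp
      _ = (t - s)⁻¹ := Real.rpow_neg_one _
      _ ≤ (t / 2)⁻¹ := inv_anti₀ (by linarith) (by linarith [hs.2])
      _ = 2 / t := by rw [inv_div]
  rw [sub_zero, abs_of_nonneg hc] at h
  calc |history p c φ t| ≤ 2 / t * C * c := h
    _ = 2 * C * c / t := by ring

lemma fracInt_eq_history {b c t : ℝ} {F : ℝ → ℝ} (hb : 0 < b) (hc : 0 ≤ c) (hct : c ≤ t)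
    (hF : ContinuousOn F (Icc 0 t)) (h0 : ∀ s ∈ Icc c t, F s = 0) :
    fracInt b F t = 1 / Real.Gamma b * history (b - 1) c F t := by
  unfold fracInt history
  have hI := intervalIntegrable_sub_rpow_mul hb (hc.trans hct) hF
  have hmem : c ∈ uIcc 0 t := by rw [uIcc_of_le (hc.trans hct)]; exact ⟨hc, hct⟩
  rw [← intervalIntegral.integral_add_adjacent_intervals
    (hI.mono_set (uIcc_subset_uIcc_left hmem)) (hI.mono_set (uIcc_subset_uIcc_right hmem)),
    intervalIntegral.integral_congr (a := c) (g := fun _ => (0:ℝ))]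
  · simp
  · intro s hs
    rw [uIcc_of_le hct] at hs
    simp [h0 s hs]

end History

section Cutoff

/-- The function `y` switched on smoothly over `[T, T + 1]`. -/
noncomputable def switchOn (T : ℝ) (y : ℝ → ℝ) (t : ℝ) : ℝ := Real.smoothTransition (t - T) * y t

lemma switchOn_of_le {T t : ℝ} (y : ℝ → ℝ) (h : t ≤ T) : switchOn T y t = 0 := by
  simp [switchOn, Real.smoothTransition.zero_of_nonpos (sub_nonpos.2 h)]

lemma switchOn_of_ge {T t : ℝ} (y : ℝ → ℝ) (h : T + 1 ≤ t) : switchOn T y t = y t := by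
  simp [switchOn, Real.smoothTransition.one_of_one_le (show 1 ≤ t - T by linarith)]

lemma contDiff_switchOn {T : ℝ} {y : ℝ → ℝ} {m : ℕ} {S : ℝ} (hS : S < T)
    (hy : ContDiffOn ℝ m y (Ici S)) : ContDiff ℝ m (switchOn T y) := by
  rw [contDiff_iff_contDiffAt]
  intro t
  rcases lt_or_ge t T with h | h
  · have : switchOn T y =ᶠ[nhds t] fun _ => 0 := by
      filter_upwards [gt_mem_nhds h] with s hs using switchOn_of_le y hs.le
    exact contDiffAt_const.congr_of_eventuallyEq this
  · have h1 : ContDiffAt ℝ m y t := hy.contDiffAt (Ici_mem_nhds (by linarith))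
    have h2 : ContDiff ℝ m fun t : ℝ => Real.smoothTransition (t - T) :=
      (Real.smoothTransition.contDiff (n := m)).comp (contDiff_id.sub contDiff_const)
    exact h2.contDiffAt.mul h1

lemma iteratedDeriv_switchOn_of_lt {T t : ℝ} (y : ℝ → ℝ) (j : ℕ) (h : t < T) :
    iteratedDeriv j (switchOn T y) t = 0 := by
  have : switchOn T y =ᶠ[nhds t] fun _ => 0 := by
    filter_upwards [gt_mem_nhds h] with s hs using switchOn_of_le y hs.le
  rw [this.iteratedDeriv_eq]
  simp

lemma hasDerivAt_iteratedDeriv {F : ℝ → ℝ} {m j : ℕ} (hF : ContDiff ℝ m F) (hj : j < m) (t : ℝ) :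
    HasDerivAt (iteratedDeriv j F) (iteratedDeriv (j + 1) F t) t := by
  rw [iteratedDeriv_succ]
  exact ((hF.differentiable_iteratedDeriv j (by exact_mod_cast hj)) t).hasDerivAt

lemma fracInt_split {b T t : ℝ} {y : ℝ → ℝ} (hb : 0 < b) (hT : 0 < T) (ht : T + 1 ≤ t)
    (hy : ContinuousOn y (Ici 0)) :
    fracInt b y t = fracInt b (switchOn T y) t
      + 1 / Real.Gamma b * history (b - 1) (T + 1) (fun s => y s - switchOn T y s) t := by
  have hc : ContinuousOn y (Icc 0 t) := hy.mono Icc_subset_Ici_self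
  have hY : ContinuousOn (switchOn T y) (Icc 0 t) :=
    ContinuousOn.mul (by have := Real.smoothTransition.continuous; fun_prop) hc
  rw [← fracInt_eq_history (F := fun s => y s - switchOn T y s) hb (by linarith) ht (hc.sub hY)
    (fun s hs => by simp [switchOn_of_ge y hs.1]),
    ← fracInt_add (G := fun s => y s - switchOn T y s) hb
    (by linarith) hY (hc.sub hY)]
  congr 1
  ext s
  ring

/-- The coefficient in front of the `j`-th derivative of a history term. -/
noncomputable def historyCoeff (b : ℝ) : ℕ → ℝ
  | 0 => 1 / Real.Gamma b
  | j + 1 => historyCoeff b j * (b - 1 - j)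

lemma iteratedDeriv_fracInt {b T : ℝ} {y : ℝ → ℝ} {m : ℕ} (hb : 0 < b) (hT : 0 < T)
    (hy : ContDiffOn ℝ m y (Ici 0)) {j : ℕ} (hj : j ≤ m) :
    ∀ t > T + 1, iteratedDeriv j (fracInt b y) t = fracInt b (iteratedDeriv j (switchOn T y)) t
      + historyCoeff b j * history (b - 1 - j) (T + 1) (fun s => y s - switchOn T y s) t := by
  have hY := contDiff_switchOn hT hy
  have hφ : ContinuousOn (fun s => y s - switchOn T y s) (Icc 0 (T + 1)) :=
    (hy.continuousOn.mono Icc_subset_Ici_self).sub hY.continuous.continuousOn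
  induction j with
  | zero =>
    intro t ht
    simpa [historyCoeff] using fracInt_split hb hT ht.le hy.continuousOn
  | succ j ih =>
    intro t ht
    have hev : iteratedDeriv j (fracInt b y) =ᶠ[nhds t] fun t =>
        fracInt b (iteratedDeriv j (switchOn T y)) t
        + historyCoeff b j * history (b - 1 - j) (T + 1) (fun s => y s - switchOn T y s) t := by
      filter_upwards [lt_mem_nhds ht] with s hs using ih (by omega) s hs
    rw [iteratedDeriv_succ, hev.deriv_eq]
    have h1 := hasDerivAt_fracInt hb (hasDerivAt_iteratedDeriv hY (by omega : j < m))
      (hY.continuous_iteratedDeriv (j + 1) (by exact_mod_cast hj))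
      (fun s hs => iteratedDeriv_switchOn_of_lt y j (by linarith))
      (fun s hs => iteratedDeriv_switchOn_of_lt y (j + 1) (by linarith)) t
    have h2 := (hasDerivAt_history (p := b - 1 - j) (by linarith) hφ ht).const_mul
      (historyCoeff b j)
    rw [(h1.fun_add h2).deriv, historyCoeff]
    push_cast
    ring_nf

lemma exists_iteratedDeriv_fracInt_eq_deriv {b T : ℝ} {y : ℝ → ℝ} {m : ℕ} (hb : 0 < b)
    (hb1 : b ≤ 1) (hT : 0 < T) (hy : ContDiffOn ℝ m y (Ici 0)) :
    ∃ H H' : ℝ → ℝ, (∀ t > T + 1, HasDerivAt H (H' t) t) ∧ ContinuousOn H' (Ioi (T + 1)) ∧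
      (∃ C, 0 ≤ C ∧ ∀ t ≥ 2 * T + 4, |H' t| ≤ C / t) ∧
      ∀ t > T + 1, iteratedDeriv (m + 1) (fracInt b y) t
        = deriv (fun s => fracInt b (iteratedDeriv m (switchOn T y)) s + H s) t := by
  have hφ : ContinuousOn (fun s => y s - switchOn T y s) (Icc 0 (T + 1)) :=
    (hy.continuousOn.mono Icc_subset_Ici_self).sub
      (contDiff_switchOn hT hy).continuous.continuousOn
  set φ := fun s => y s - switchOn T y s
  have hT1 : 0 ≤ T + 1 := by linarith
  refine ⟨fun t => historyCoeff b m * history (b - 1 - m) (T + 1) φ t,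
    fun t => historyCoeff b m * ((b - 1 - m) * history (b - 1 - m - 1) (T + 1) φ t),
    fun t ht => (hasDerivAt_history hT1 hφ ht).const_mul _,
    continuousOn_const.mul (continuousOn_const.mul (continuousOn_history hT1 hφ)), ?_, ?_⟩
  · obtain ⟨C, hC0, hC⟩ := exists_history_bound (p := b - 1 - m - 1)
      (by have : (0:ℝ) ≤ m := m.cast_nonneg; linarith) hT1 hφ
    refine ⟨|historyCoeff b m * (b - 1 - m)| * C, by positivity, fun t ht => ?_⟩
    simp only
    rw [← mul_assoc, abs_mul, mul_div_assoc]
    exact mul_le_mul_of_nonneg_left (hC t (by linarith)) (abs_nonneg _)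
  · intro t ht
    rw [iteratedDeriv_succ]
    refine Filter.EventuallyEq.deriv_eq ?_
    filter_upwards [lt_mem_nhds ht] with s hs using iteratedDeriv_fracInt hb hT hy le_rfl s hs

end Cutoff

section MaximumPrinciple

open scoped Topology

lemma differentiableAt_fracInt {b t₀ : ℝ} (hb : 0 < b) (ht₀ : 0 < t₀) {G : ℝ → ℝ}
    (hc : Continuous G) (hG : ∀ᶠ t in 𝓝 t₀, ContDiffAt ℝ 1 G t) :
    DifferentiableAt ℝ (fracInt b G) t₀ := by
  obtain ⟨r, hr, hball⟩ := Metric.eventually_nhds_iff.1 hG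
  set R := min r t₀ / 2 with hR
  have hRpos : 0 < R := by positivity
  have hRr : R < r := by have := min_le_left r t₀; linarith
  have hRt : R < t₀ := by have := min_le_right r t₀; linarith
  let f : ContDiffBump t₀ := ⟨R / 2, R, by linarith, by linarith⟩
  set G₁ : ℝ → ℝ := fun s => f s * G s with hG₁
  have hzero : ∀ s, R < dist s t₀ → G₁ =ᶠ[𝓝 s] fun _ => 0 := by
    intro s hs
    have : ∀ᶠ u in 𝓝 s, R < dist u t₀ :=
      (continuous_id.dist continuous_const).continuousAt.eventually (lt_mem_nhds hs)
    filter_upwards [this] with u hu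
    simp [hG₁, f.zero_of_le_dist hu.le]
  have hleft : ∀ s ≤ 0, R < dist s t₀ := by
    intro s hs
    rw [Real.dist_eq, abs_sub_comm, abs_of_pos (by linarith)]
    linarith
  have hG₁d : ContDiff ℝ 1 G₁ := by
    rw [contDiff_iff_contDiffAt]
    intro s
    rcases lt_or_ge (dist s t₀) r with h | h
    · exact f.contDiff.contDiffAt.mul (hball h)
    · exact contDiffAt_const.congr_of_eventuallyEq (hzero s (by linarith))
  have hd := hasDerivAt_fracInt hb
    (fun t => (hG₁d.differentiable (by norm_num) t).hasDerivAt)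
    (hG₁d.continuous_deriv le_rfl) (fun s hs => (hzero s (hleft s hs)).self_of_nhds)
    (fun s hs => by rw [(hzero s (hleft s hs)).deriv_eq]; simp) t₀
  have hcc : 0 ≤ t₀ - R / 2 := by linarith
  have hdiff : Continuous fun s => G s - G₁ s := hc.sub hG₁d.continuous
  have hh := (hasDerivAt_history (p := b - 1) (t := t₀) hcc (hdiff.continuousOn)
    (by linarith)).const_mul (1 / Real.Gamma b)
  refine ((hd.fun_add hh).differentiableAt).congr_of_eventuallyEq ?_
  filter_upwards [Ioo_mem_nhds (show t₀ - R / 2 < t₀ by linarith)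
    (show t₀ < t₀ + R / 2 by linarith)] with t ht
  rw [← fracInt_eq_history (F := fun s => G s - G₁ s) hb hcc ht.1.le hdiff.continuousOn,
    ← fracInt_add (G := fun s => G s - G₁ s) hb (hcc.trans ht.1.le)
      hG₁d.continuous.continuousOn hdiff.continuousOn]
  · congr 1
    ext s
    ring
  · intro s hs
    have : f s = 1 := f.one_of_mem_closedBall (by
      have hrIn : f.rIn = R / 2 := rfl
      rw [Metric.mem_closedBall, Real.dist_eq, abs_le, hrIn]
      exact ⟨by linarith [hs.1], by linarith [hs.2, ht.2]⟩)
    simp [hG₁, this]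

lemma fracInt_comp_sub {b h t : ℝ} {U : ℝ → ℝ} (hb : 0 < b) (hU : Continuous U)
    (h0 : ∀ s ≤ 0, U s = 0) (hh : 0 ≤ h) :
    fracInt b (fun s => U (s - h)) t = fracInt b U (t - h) := by
  unfold fracInt
  congr 1
  have e := intervalIntegral.integral_comp_sub_right (a := 0) (b := t)
    (fun s : ℝ => (t - h - s) ^ (b - 1) * U s) h
  have e' : (fun x => (t - h - (x - h)) ^ (b - 1) * U (x - h))
      = fun s => (t - s) ^ (b - 1) * U (s - h) := by
    ext s
    ring_nf
  rw [e', zero_sub] at e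
  have hint : ∀ u v, IntervalIntegrable (fun s => (t - h - s) ^ (b - 1) * U s) volume u v :=
    fun u v => (intervalIntegrable_sub_rpow hb _ _ _).mul_continuousOn hU.continuousOn
  rw [e, ← intervalIntegral.integral_add_adjacent_intervals (hint (-h) 0) (hint 0 _),
    intervalIntegral.integral_congr (a := -h) (g := fun _ => (0:ℝ))]
  · simp
  · intro s hs
    rw [uIcc_of_le (by linarith)] at hs
    simp [h0 s hs.2]

/-- Over a step of length `h`, the fractional integral of a nonnegative function that vanishes
to first order at the endpoint grows by at most `O(h ^ (1 + b))`. -/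
lemma fracInt_sub_fracInt_le {b t h C : ℝ} (hb : 0 < b) (hb1 : b < 1) (hh : 0 < h) (hht : h ≤ t)
    {k : ℝ → ℝ} (hk : Continuous k) (hk0 : ∀ s ∈ Icc 0 t, 0 ≤ k s)
    (hkC : ∀ s ∈ Icc (t - h) t, k s ≤ C * h) :
    fracInt b k t - fracInt b k (t - h) ≤ 1 / Real.Gamma b * (C / b) * (h ^ b * h) := by
  have hint : ∀ x u v, IntervalIntegrable (fun s => (x - s) ^ (b - 1) * k s) volume u v :=
    fun x u v => (intervalIntegrable_sub_rpow hb _ _ _).mul_continuousOn hk.continuousOn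
  have hΓ := Real.Gamma_pos_of_pos hb
  have h1 : ∫ s in (0:ℝ)..(t - h), (t - s) ^ (b - 1) * k s
      ≤ ∫ s in (0:ℝ)..(t - h), (t - h - s) ^ (b - 1) * k s := by
    refine intervalIntegral.integral_mono_on_of_le_Ioo (by linarith) (hint _ _ _) (hint _ _ _)
      fun s hs => ?_
    refine mul_le_mul_of_nonneg_right ?_ (hk0 s ⟨hs.1.le, by linarith [hs.2]⟩)
    exact Real.rpow_le_rpow_of_nonpos (by linarith [hs.2]) (by linarith) (by linarith)
  have h2 : ∫ s in (t - h)..t, (t - s) ^ (b - 1) * k s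
      ≤ ∫ s in (t - h)..t, (t - s) ^ (b - 1) * (C * h) := by
    refine intervalIntegral.integral_mono_on (by linarith) (hint _ _ _)
      ((intervalIntegrable_sub_rpow hb _ _ _).mul_const _) fun s hs => ?_
    exact mul_le_mul_of_nonneg_left (hkC s hs) (Real.rpow_nonneg (by linarith [hs.2]) _)
  have h3 : ∫ s in (t - h)..t, (t - s) ^ (b - 1) = h ^ b / b := by
    have h := intervalIntegral.integral_comp_sub_left (a := t - h) (b := t)
      (fun s : ℝ => s ^ (b - 1)) t
    rw [h, sub_self, sub_sub_cancel, integral_rpow (Or.inl (by linarith)), sub_add_cancel,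
      Real.zero_rpow hb.ne', sub_zero]
  rw [intervalIntegral.integral_mul_const, h3] at h2
  unfold fracInt
  rw [← mul_sub, ← intervalIntegral.integral_add_adjacent_intervals (hint t 0 (t - h))
    (hint t (t - h) t), mul_assoc]
  refine mul_le_mul_of_nonneg_left ?_ (by positivity)
  calc _ ≤ h ^ b / b * (C * h) := by linarith
    _ = _ := by ring

/-- At a nonnegative running maximum, the Riemann–Liouville derivative is nonnegative. -/
lemma nonneg_of_hasDerivAt_fracInt_of_max {b t d : ℝ} (hb : 0 < b) (hb1 : b < 1) (ht : 0 < t)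
    {p : ℝ → ℝ} (hp : Continuous p) (hmax : ∀ s ∈ Icc 0 t, p s ≤ p t) (hpt : 0 ≤ p t)
    (hd : DifferentiableAt ℝ p t) (hD : HasDerivAt (fracInt b p) d t) : 0 ≤ d := by
  obtain ⟨C, hC⟩ := hd.isBigO_sub.bound
  obtain ⟨δ, hδ, hball⟩ := Metric.eventually_nhds_iff.1 hC
  set k : ℝ → ℝ := fun s => p t - p s with hk
  have hkc : Continuous k := continuous_const.sub hp
  have hΓ := Real.Gamma_pos_of_pos hb
  set K := 1 / Real.Gamma b * (|C| / b)
  have hlim : Tendsto (fun u : ℝ => -(K * (-u) ^ b)) (𝓝[<] 0) (𝓝 0) := by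
    have : Continuous fun u : ℝ => -(K * (-u) ^ b) :=
      (continuous_const.mul (continuous_neg.rpow_const fun _ => Or.inr hb.le)).neg
    have h := this.tendsto 0
    simp only [neg_zero, Real.zero_rpow hb.ne', mul_zero] at h
    exact h.mono_left nhdsWithin_le_nhds
  refine le_of_tendsto_of_tendsto hlim hD.tendsto_slope_zero_left ?_
  have hmin : -min δ t < 0 := by simp [hδ, ht]
  filter_upwards [Ioo_mem_nhdsLT hmin] with u hu
  obtain ⟨h, rfl⟩ : ∃ h, u = -h := ⟨-u, by ring⟩
  have hh : 0 < h := by linarith [hu.2]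
  have hhδ : h < δ := by linarith [hu.1, min_le_left δ t]
  have hht : h < t := by linarith [hu.1, min_le_right δ t]
  have hdec : ∀ x, 0 ≤ x →
      fracInt b p x = p t * (x ^ b / (b * Real.Gamma b)) - fracInt b k x := by
    intro x hx
    rw [← fracInt_const hb (p t), ← fracInt_sub hb hx continuousOn_const hkc.continuousOn]
    congr 1
    ext s
    simp [hk]
  have hstep := fracInt_sub_fracInt_le (C := |C|) hb hb1 hh hht.le hkc
    (fun s hs => sub_nonneg.2 (hmax s hs)) (fun s hs => by
      have hs' : |s - t| ≤ h := abs_le.2 ⟨by linarith [hs.1], by linarith [hs.2]⟩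
      have h1 := hball (y := s) (by rw [Real.dist_eq]; linarith)
      calc k s ≤ ‖p s - p t‖ := by rw [Real.norm_eq_abs, abs_sub_comm]; exact le_abs_self _
        _ ≤ C * ‖s - t‖ := h1
        _ ≤ |C| * ‖s - t‖ := mul_le_mul_of_nonneg_right (le_abs_self C) (norm_nonneg _)
        _ ≤ |C| * h := mul_le_mul_of_nonneg_left hs' (abs_nonneg _))
  have hmono : p t * ((t - h) ^ b / (b * Real.Gamma b)) ≤ p t * (t ^ b / (b * Real.Gamma b)) := by
    refine mul_le_mul_of_nonneg_left ?_ hpt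
    have := Real.rpow_le_rpow (by linarith) (show t - h ≤ t by linarith) hb.le
    gcongr
  have hfin : -(K * (h ^ b * h)) ≤ fracInt b p t - fracInt b p (t - h) := by
    rw [hdec t ht.le, hdec (t - h) (by linarith)]
    linarith
  rw [neg_neg, smul_eq_mul, ← sub_eq_add_neg]
  have : (-h)⁻¹ * (fracInt b p (t - h) - fracInt b p t)
      = (fracInt b p t - fracInt b p (t - h)) / h := by
    field_simp
    ring
  rw [this, le_div_iff₀ hh]
  linarith

/-- A maximum principle: if the Riemann–Liouville derivative `N` of `U' = u` decreases wherever
`u` is positive, then `u` cannot become positive. -/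
lemma nonpos_of_rlDeriv_decreasing {b S : ℝ} (hb : 0 < b) (hb1 : b < 1) (hS : 0 ≤ S)
    {U u N : ℝ → ℝ} (hU : Continuous U) (hU0 : ∀ s ≤ 0, U s = 0)
    (hanti : AntitoneOn U (Iic (S + 1)))
    (hUd : ∀ t ≥ S, HasDerivAt U (u t) t) (hu : ContinuousOn u (Ici S))
    (hN : ∀ t ≥ S, HasDerivAt (fracInt b U) (N t) t)
    (hdec : ∀ t ≥ S, 0 < u t → ∃ N' < 0, HasDerivAt N N' t) :
    ∀ t ≥ S + 1, u t ≤ 0 := by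
  by_contra! hcon
  obtain ⟨t₁, ht₁, hpos⟩ := hcon
  have huc : UniformContinuousOn u (Icc S t₁) :=
    isCompact_Icc.uniformContinuousOn_of_continuous (hu.mono Icc_subset_Ici_self)
  obtain ⟨δ, hδ, hosc⟩ := Metric.uniformContinuousOn_iff.1 huc (u t₁ / 2) (by linarith)
  obtain ⟨h, hh, hhδ⟩ := exists_between (show 0 < min δ 1 by positivity)
  have hhδ' : h < δ := hhδ.trans_le (min_le_left _ _)
  have hh1 : h < 1 := hhδ.trans_le (min_le_right _ _)
  have hclose : ∀ s ∈ Icc S t₁, ∀ r ∈ Icc S t₁, |s - r| ≤ h → u r - u t₁ / 2 < u s := by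
    intro s hs r hr hsr
    have := hosc s hs r hr (by rw [Real.dist_eq]; linarith)
    rw [Real.dist_eq] at this
    linarith [(abs_lt.1 this).1]
  set p : ℝ → ℝ := fun t => U t - U (t - h) with hp
  have hpc : Continuous p := by fun_prop
  have hmvt : ∀ t ≥ S + 1, ∃ r ∈ Ioo (t - h) t, p t = h * u r := by
    intro t ht
    obtain ⟨r, hr, hr'⟩ := exists_hasDerivAt_eq_slope U u (show t - h < t by linarith)
      hU.continuousOn (fun x hx => hUd x (by linarith [hx.1]))
    refine ⟨r, hr, ?_⟩
    rw [hr', sub_sub_cancel]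
    field_simp
    rfl
  obtain ⟨t, ht, htmax⟩ := isCompact_Icc.exists_isMaxOn (nonempty_Icc.2 ht₁) hpc.continuousOn
  have hp1 : h * (u t₁ / 2) < p t := by
    obtain ⟨r, hr, hpr⟩ := hmvt t₁ ht₁
    have hr2 := hclose r ⟨by linarith [hr.1], hr.2.le⟩ t₁ ⟨by linarith, le_rfl⟩
      (abs_le.2 ⟨by linarith [hr.1], by linarith [hr.2]⟩)
    have : p t₁ ≤ p t := htmax ⟨ht₁, le_rfl⟩
    have : h * (u t₁ / 2) < h * u r := mul_lt_mul_of_pos_left (by linarith) hh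
    linarith
  have hpt : 0 < p t := lt_trans (by positivity) hp1
  have hle : ∀ s ≤ S + 1, p s ≤ 0 := by
    intro s hs
    have := hanti (show s - h ∈ Iic (S + 1) by simp only [mem_Iic]; linarith) hs (by linarith)
    simp only [hp]
    linarith
  have htS : S + 1 < t := by
    by_contra! hts
    linarith [hle t hts]
  have hrun : ∀ s ∈ Icc 0 t, p s ≤ p t := by
    intro s hs
    rcases le_total s (S + 1) with h1 | h1
    · exact (hle s h1).trans hpt.le
    · exact htmax ⟨h1, hs.2.trans ht.2⟩
  have hupos : ∀ s ∈ Icc (t - h) t, 0 < u s := by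
    intro s hs
    obtain ⟨r, hr, hpr⟩ := hmvt t htS.le
    have hr2 := hclose s ⟨by linarith [hs.1], hs.2.trans ht.2⟩ r
      ⟨by linarith [hr.1], by linarith [hr.2, ht.2]⟩
      (abs_le.2 ⟨by linarith [hs.1, hr.2], by linarith [hs.2, hr.1]⟩)
    rw [hpr] at hp1
    have := lt_of_mul_lt_mul_left hp1 hh.le
    linarith
  have hNlt : N t < N (t - h) := by
    choose! N' hN'neg hN'd using hdec
    have hd : ∀ x ∈ Icc (t - h) t, HasDerivAt N (N' x) x := fun x hx =>
      hN'd x (by linarith [hx.1]) (hupos x hx)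
    obtain ⟨r, hr, hr'⟩ := exists_hasDerivAt_eq_slope N N' (show t - h < t by linarith)
      (fun x hx => (hd x hx).continuousAt.continuousWithinAt)
      (fun x hx => hd x ⟨hx.1.le, hx.2.le⟩)
    have h1 := hN'neg r (by linarith [hr.1]) (hupos r ⟨hr.1.le, hr.2.le⟩)
    rw [hr', div_lt_iff₀ (by linarith)] at h1
    linarith
  have hpd : HasDerivAt (fracInt b p) (N t - N (t - h)) t := by
    have h2 : HasDerivAt (fun s => fracInt b U (s - h)) (N (t - h)) t :=
      HasDerivAt.comp_sub_const t h (hN (t - h) (by linarith))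
    refine ((hN t (by linarith)).fun_sub h2).congr_of_eventuallyEq ?_
    filter_upwards [lt_mem_nhds (show h < t by linarith)] with s hs
    rw [← fracInt_comp_sub hb hU hU0 hh.le]
    exact fracInt_sub hb (by linarith) hU.continuousOn (by fun_prop)
  have hdp : DifferentiableAt ℝ p t :=
    (hUd t (by linarith)).differentiableAt.fun_sub
      (HasDerivAt.comp_sub_const t h (hUd (t - h) (by linarith))).differentiableAt
  have := nonneg_of_hasDerivAt_fracInt_of_max hb hb1 (by linarith) hpc hrun hpt.le hdp hpd
  linarith

end MaximumPrinciple

section Comparison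

open scoped Topology

lemma contDiffOn_one_of_hasDerivAt {s : Set ℝ} (hs : IsOpen s) {F F' : ℝ → ℝ}
    (hF : ∀ t ∈ s, HasDerivAt F (F' t) t) (hF' : ContinuousOn F' s) : ContDiffOn ℝ 1 F s := by
  have h := (contDiffOn_succ_iff_deriv_of_isOpen (𝕜 := ℝ) (n := 0) (f := F) hs).2
    ⟨fun t ht => (hF t ht).differentiableAt.differentiableWithinAt, by simp,
      contDiffOn_zero.2 (hF'.congr fun t ht => (hF t ht).deriv)⟩
  simpa using h

lemma fracInt_max_rpow {b p t : ℝ} (hb : 0 < b) (hp : 0 < p) (ht : 0 < t) :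
    fracInt b (fun s => (max s 0) ^ p) t
      = Real.Gamma (p + 1) / Real.Gamma (p + 1 + b) * t ^ (p + b) := by
  have h := integral_rpow_mul_sub_rpow (a := p + 1) (by linarith) hb ht
  have hΓ := (Real.Gamma_pos_of_pos hb).ne'
  unfold fracInt
  rw [intervalIntegral.integral_congr (g := fun s => s ^ (p + 1 - 1) * (t - s) ^ (b - 1)), h]
  · rw [show p + 1 + b - 1 = p + b by ring]
    field_simp
  · intro s hs
    rw [uIcc_of_le ht.le] at hs
    simp [max_eq_left hs.1, mul_comm]

/-- The primitive of `t ^ (-r)` on the positive half-line, extended by zero. -/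
noncomputable def powerBarrier (r t : ℝ) : ℝ := (max t 0) ^ (1 - r) / (1 - r)

lemma continuous_powerBarrier {r : ℝ} (hr : r < 1) : Continuous (powerBarrier r) :=
  ((continuous_id.max continuous_const).rpow_const fun _ => Or.inr (by linarith)).div_const _

lemma powerBarrier_of_nonpos {r t : ℝ} (hr : r < 1) (ht : t ≤ 0) : powerBarrier r t = 0 := by
  rw [powerBarrier, max_eq_right ht, Real.zero_rpow (by linarith), zero_div]

lemma hasDerivAt_powerBarrier {r t : ℝ} (hr : r < 1) (ht : 0 < t) :
    HasDerivAt (powerBarrier r) (t ^ (-r)) t := by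
  have h := (Real.hasDerivAt_rpow_const (x := t) (p := 1 - r) (Or.inl ht.ne')).div_const (1 - r)
  rw [mul_div_cancel_left₀ _ (by linarith), show 1 - r - 1 = -r by ring] at h
  refine h.congr_of_eventuallyEq ?_
  filter_upwards [lt_mem_nhds ht] with s hs
  rw [powerBarrier, max_eq_left hs.le]

lemma exists_hasDerivAt_fracInt_powerBarrier {b r : ℝ} (hb : 0 < b) (hr : r < 1) :
    ∃ B ≥ 0, ∃ N N' : ℝ → ℝ, ∀ t > 0, HasDerivAt (fracInt b (powerBarrier r)) (N t) t ∧
      HasDerivAt N (N' t) t ∧ |N' t| ≤ B * t ^ (b - 1 - r) := by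
  set C := 1 / (1 - r) * (Real.Gamma (1 - r + 1) / Real.Gamma (1 - r + 1 + b))
  set p := 1 - r + b
  refine ⟨|C * p * (p - 1)|, abs_nonneg _, fun t => C * p * t ^ (p - 1),
    fun t => C * p * ((p - 1) * t ^ (p - 1 - 1)), fun t ht => ⟨?_, ?_, ?_⟩⟩
  · have h := (Real.hasDerivAt_rpow_const (x := t) (p := p) (Or.inl ht.ne')).const_mul C
    rw [← mul_assoc] at h
    refine h.congr_of_eventuallyEq ?_
    filter_upwards [lt_mem_nhds ht] with s hs
    have e : powerBarrier r = fun s => 1 / (1 - r) * (max s 0) ^ (1 - r) := by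
      ext s
      rw [powerBarrier]
      ring
    rw [e, fracInt_const_mul, fracInt_max_rpow hb (by linarith) hs, mul_assoc]
  · exact (Real.hasDerivAt_rpow_const (Or.inl ht.ne')).const_mul _
  · change |C * p * ((p - 1) * t ^ (p - 1 - 1))| ≤ _
    rw [← mul_assoc, abs_mul, abs_of_nonneg (Real.rpow_nonneg ht.le (p - 1 - 1)),
      show p - 1 - 1 = b - 1 - r by simp only [p]; ring]

/-- For a `C¹` function supported on the half-line, subtracting a large multiple of a more
singular power makes it decreasing. -/
lemma exists_antitoneOn_sub_powerBarrier {L r ρ ε : ℝ} (hL : 1 ≤ L) (hρ0 : 0 < ρ) (hρ : ρ < r)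
    (hr : r < 1) (hε : 0 < ε) {G : ℝ → ℝ} (hG : ContDiff ℝ 1 G) (hG0 : ∀ t ≤ 0, G t = 0) :
    ∃ M > 0, AntitoneOn (fun t => G t - (M * powerBarrier r t - ε * powerBarrier ρ t)) (Iic L) := by
  obtain ⟨K, hK⟩ := isCompact_Icc.exists_bound_of_continuousOn (s := Icc 0 L)
    (hG.continuous_deriv le_rfl).continuousOn
  have hK0 : 0 ≤ K := (norm_nonneg _).trans (hK 0 ⟨le_rfl, by linarith⟩)
  have hL0 : 0 < L := by linarith
  refine ⟨L ^ (r - ρ) * (ε + K * L ^ ρ), by positivity, ?_⟩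
  set M := L ^ (r - ρ) * (ε + K * L ^ ρ) with hM
  set F := fun t => G t - (M * powerBarrier r t - ε * powerBarrier ρ t)
  have hneg : AntitoneOn F (Iic 0) := by
    intro s hs t ht _
    simp [F, hG0 s hs, hG0 t ht, powerBarrier_of_nonpos hr hs, powerBarrier_of_nonpos hr ht,
      powerBarrier_of_nonpos (hρ.trans hr) hs, powerBarrier_of_nonpos (hρ.trans hr) ht]
  have hpos : AntitoneOn F (Icc 0 L) := by
    have hFd : ∀ t > 0, HasDerivAt F (deriv G t - (M * t ^ (-r) - ε * t ^ (-ρ))) t := fun t ht =>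
      (hG.differentiable (by norm_num) t).hasDerivAt.fun_sub
        (((hasDerivAt_powerBarrier hr ht).const_mul M).fun_sub
          ((hasDerivAt_powerBarrier (hρ.trans hr) ht).const_mul ε))
    refine antitoneOn_of_deriv_nonpos (convex_Icc _ _) ?_ ?_ ?_
    · have := continuous_powerBarrier hr
      have := continuous_powerBarrier (hρ.trans hr)
      have := hG.continuous
      fun_prop
    · intro t ht
      rw [interior_Icc] at ht
      exact (hFd t ht.1).differentiableAt.differentiableWithinAt
    · intro t ht
      rw [interior_Icc] at ht
      rw [(hFd t ht.1).deriv]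
      have h1 : deriv G t ≤ K := (le_abs_self _).trans (hK t ⟨ht.1.le, ht.2.le⟩)
      have h2 : L ^ (ρ - r) ≤ t ^ (ρ - r) :=
        Real.rpow_le_rpow_of_nonpos ht.1 ht.2.le (by linarith)
      have h3 : L ^ (-ρ) ≤ t ^ (-ρ) :=
        Real.rpow_le_rpow_of_nonpos ht.1 ht.2.le (by linarith)
      have h4 : t ^ (-r) = t ^ (-ρ) * t ^ (ρ - r) := by
        rw [← Real.rpow_add ht.1]; ring_nf
      have h5 : L ^ (r - ρ) * L ^ (ρ - r) = 1 := by
        rw [← Real.rpow_add hL0]; simp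
      have h6 : L ^ ρ * L ^ (-ρ) = 1 := by
        rw [← Real.rpow_add hL0]; simp
      have h7 : ε + K * L ^ ρ ≤ M * t ^ (ρ - r) := by
        calc ε + K * L ^ ρ = L ^ (r - ρ) * L ^ (ρ - r) * (ε + K * L ^ ρ) := by rw [h5, one_mul]
          _ = M * L ^ (ρ - r) := by rw [hM]; ring
          _ ≤ _ := mul_le_mul_of_nonneg_left h2 (by positivity)
      have h8 : K ≤ K * L ^ ρ * t ^ (-ρ) := by
        calc K = K * (L ^ ρ * L ^ (-ρ)) := by rw [h6, mul_one]
          _ = K * L ^ ρ * L ^ (-ρ) := by ring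
          _ ≤ _ := mul_le_mul_of_nonneg_left h3 (by positivity)
      have h9 := mul_le_mul_of_nonneg_right h7 (Real.rpow_nonneg ht.1.le (-ρ))
      rw [h4]
      linarith
  have := hneg.union_right hpos isGreatest_Iic (isLeast_Icc hL0.le)
  rwa [Iic_union_Icc_eq_Iic hL0.le] at this

lemma eventually_div_lt_rpow_neg {ρ c : ℝ} (hρ : ρ < 1) (hc : 0 < c) (C : ℝ) :
    ∀ᶠ t : ℝ in atTop, C / t < c * t ^ (-ρ) := by
  have h := (tendsto_rpow_neg_atTop (show 0 < 1 - ρ by linarith)).const_mul C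
  rw [mul_zero] at h
  filter_upwards [h.eventually (gt_mem_nhds hc), eventually_gt_atTop 0] with t ht ht0
  have e : C / t = C * t ^ (-(1 - ρ)) * t ^ (-ρ) := by
    rw [mul_assoc, ← Real.rpow_add ht0, show -(1 - ρ) + -ρ = -1 by ring, Real.rpow_neg_one,
      div_eq_mul_inv]
  rw [e]
  exact mul_lt_mul_of_pos_right ht (by positivity)

lemma eventually_mul_rpow_neg_le {r ρ c : ℝ} (hρ : ρ < r) (hc : 0 < c) (C : ℝ) :
    ∀ᶠ t : ℝ in atTop, C * t ^ (-r) ≤ c * t ^ (-ρ) := by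
  have h := (tendsto_rpow_neg_atTop (show 0 < r - ρ by linarith)).const_mul C
  rw [mul_zero] at h
  filter_upwards [h.eventually (gt_mem_nhds hc), eventually_gt_atTop 0] with t ht ht0
  have e : t ^ (-r) = t ^ (-(r - ρ)) * t ^ (-ρ) := by
    rw [← Real.rpow_add ht0]
    ring_nf
  rw [e, ← mul_assoc]
  exact mul_le_mul_of_nonneg_right ht.le (by positivity)

/-- Removing the history of `fracInt κ G` before `T` changes the Riemann–Liouville derivative,
which is `G`, by a term with derivative `O(1 / t)`. -/
lemma exists_hasDerivAt_fracInt_switchOn {κ T : ℝ} (hκ0 : 0 < κ) (hκ1 : κ < 1) (hT : 0 < T)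
    {G : ℝ → ℝ} (hG : Continuous G) (hG0 : ∀ s ≤ 0, G s = 0) :
    ∃ R R' : ℝ → ℝ, ∃ C ≥ 0,
      (∀ t > T + 1, HasDerivAt (fracInt (1 - κ) (switchOn T (fracInt κ G))) (G t - R t) t ∧
        HasDerivAt R (R' t) t) ∧ ∀ t ≥ 2 * T + 4, |R' t| ≤ C / t := by
  have hGβ := continuous_fracInt hκ0 hG hG0
  set φ := fun s => fracInt κ G s - switchOn T (fracInt κ G) s with hφ
  have hφc : ContinuousOn φ (Icc 0 (T + 1)) :=
    (hGβ.sub ((Real.smoothTransition.continuous.comp (continuous_id.sub continuous_const)).mul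
      hGβ)).continuousOn
  have hT1 : 0 ≤ T + 1 := by linarith
  set c := 1 / Real.Gamma (1 - κ)
  set p := 1 - κ - 1 with hp
  obtain ⟨C, hC, hCb⟩ := exists_history_bound (p := p - 1 - 1) (by linarith) hT1 hφc
  refine ⟨fun t => c * (p * history (p - 1) (T + 1) φ t),
    fun t => c * (p * ((p - 1) * history (p - 1 - 1) (T + 1) φ t)),
    |c * (p * (p - 1))| * C, by positivity, fun t ht => ⟨?_, ?_⟩, fun t ht => ?_⟩
  · have h := (hasDerivAt_integral_zero hG t).fun_sub
      ((hasDerivAt_history (p := p) hT1 hφc ht).const_mul c)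
    refine h.congr_of_eventuallyEq ?_
    filter_upwards [lt_mem_nhds ht] with s hs
    have e := fracInt_split (b := 1 - κ) (by linarith) hT hs.le hGβ.continuousOn
    rw [fracInt_fracInt (by linarith) hκ0 hG hG0, sub_add_cancel, fracInt_one] at e
    rw [e]
    ring
  · exact ((hasDerivAt_history hT1 hφc ht).const_mul _).const_mul _
  · have h := mul_le_mul_of_nonneg_left (hCb t (by linarith)) (abs_nonneg (c * (p * (p - 1))))
    rw [← abs_mul] at h
    rw [mul_div_assoc]
    convert! h using 2
    ring

/-- A comparison principle for the fractional relaxation inequality `z + a v ≤ -c t ^ (-ρ)`, where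
`z` and `v` are the derivatives of `G` and of `fracInt κ G`. -/
theorem exists_le_neg_rpow_of_fracRelaxation {κ a c ρ T : ℝ} (hκ0 : 0 < κ) (hκ1 : κ < 1)
    (ha : 0 < a) (hc : 0 < c) (hρ0 : 0 < ρ) (hρ1 : ρ < 1) (hT : 0 < T) {G v : ℝ → ℝ}
    (hG : Continuous G) (hG0 : ∀ s ≤ 0, G s = 0)
    (hv : ∀ t ≥ T, HasDerivAt (fracInt κ G) (v t) t) (hvc : ContinuousOn v (Ici T))
    (hrel : ∀ t ≥ T, a * v t ≤ -(c * t ^ (-ρ)) ∨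
      ∃ z, HasDerivAt G z t ∧ z + a * v t ≤ -(c * t ^ (-ρ))) :
    ∃ ε > 0, ∀ᶠ t in atTop, v t ≤ -(ε * t ^ (-ρ)) := by
  obtain ⟨r, hρr, hr1⟩ := exists_between hρ1
  set T' := T + 1 with hT'
  have hT'0 : 0 < T' := by linarith
  set Gh := switchOn T' (fracInt κ G) with hGh
  have hGhd : ContDiff ℝ 1 Gh := by
    refine contDiff_switchOn (m := 1) (S := T + 1 / 2) (by linarith) ?_
    refine ContDiffOn.mono (contDiffOn_one_of_hasDerivAt isOpen_Ioi (fun t ht => hv t ht.le)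
      (hvc.mono Ioi_subset_Ici_self)) ?_
    intro t ht
    simp only [mem_Ici, mem_Ioi] at *
    linarith
  have hGh0 : ∀ t ≤ 0, Gh t = 0 := fun t ht => switchOn_of_le _ (by linarith)
  obtain ⟨R, R', C, hC, hR, hRC⟩ := exists_hasDerivAt_fracInt_switchOn hκ0 hκ1 hT'0 hG hG0
  have hb : 0 < 1 - κ := by linarith
  obtain ⟨B₁, hB₁, N₁, N₁', hN₁⟩ := exists_hasDerivAt_fracInt_powerBarrier (r := r) hb hr1
  obtain ⟨B₂, hB₂, N₂, N₂', hN₂⟩ := exists_hasDerivAt_fracInt_powerBarrier (r := ρ) hb hρ1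
  set ε := c / (2 * (a + B₂)) with hε
  have hε0 : 0 < ε := by positivity
  have hεc : (a + B₂) * ε = c / 2 := by rw [hε]; field_simp
  have hlim : ∀ᶠ t : ℝ in atTop, B₁ * t ^ (-κ) ≤ a := by
    have h := (tendsto_rpow_neg_atTop hκ0).const_mul B₁
    rw [mul_zero] at h
    exact (h.eventually (gt_mem_nhds ha)).mono fun t ht => ht.le
  obtain ⟨S, hS⟩ := eventually_atTop.1 (hlim.and ((eventually_div_lt_rpow_neg hρ1
    (half_pos hc) C).and (eventually_ge_atTop (2 * T' + 4))))
  have hSge : 2 * T' + 4 ≤ S := (hS S le_rfl).2.2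
  obtain ⟨M, hM, hanti⟩ := exists_antitoneOn_sub_powerBarrier (L := S + 1) (by linarith) hρ0 hρr
    hr1 hε0 hGhd hGh0
  have key := nonpos_of_rlDeriv_decreasing (b := 1 - κ) (S := S) hb (by linarith) (by linarith)
    (U := fun t => Gh t - (M * powerBarrier r t - ε * powerBarrier ρ t))
    (u := fun t => v t - (M * t ^ (-r) - ε * t ^ (-ρ)))
    (N := fun t => G t - R t - (M * N₁ t - ε * N₂ t))
    ?_ ?_ hanti ?_ ?_ ?_ ?_
  · refine ⟨ε / 2, by positivity, ?_⟩
    filter_upwards [eventually_ge_atTop (S + 1), eventually_mul_rpow_neg_le hρr (half_pos hε0) M]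
      with t ht hMt
    linarith [key t ht]
  · have := continuous_powerBarrier hr1
    have := continuous_powerBarrier hρ1
    have := hGhd.continuous
    fun_prop
  · intro s hs
    simp [hGh0 s hs, powerBarrier_of_nonpos hr1 hs, powerBarrier_of_nonpos hρ1 hs]
  · intro t ht
    have ht0 : 0 < t := by linarith
    have h1 : HasDerivAt Gh (v t) t := by
      refine (hv t (by linarith)).congr_of_eventuallyEq ?_
      filter_upwards [lt_mem_nhds (show T' + 1 < t by linarith)] with s hs
        using switchOn_of_ge _ hs.le
    exact h1.fun_sub (((hasDerivAt_powerBarrier hr1 ht0).const_mul M).fun_sub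
      ((hasDerivAt_powerBarrier hρ1 ht0).const_mul ε))
  · have hpow : ∀ p : ℝ, ContinuousOn (fun t : ℝ => t ^ p) (Ici S) := fun p t ht =>
      (Real.continuousAt_rpow_const t p
        (Or.inl (by simp only [mem_Ici] at ht; linarith))).continuousWithinAt
    exact (hvc.mono (Ici_subset_Ici.2 (by linarith))).sub
      (((hpow _).const_smul M).sub ((hpow _).const_smul ε))
  · intro t ht
    have ht0 : 0 < t := by linarith
    have h := (hR t (by linarith)).1.fun_sub
      (((hN₁ t ht0).1.const_mul M).fun_sub ((hN₂ t ht0).1.const_mul ε))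
    refine h.congr_of_eventuallyEq ?_
    filter_upwards [lt_mem_nhds ht0] with s hs
    have c1 := continuous_powerBarrier hr1
    have c2 := continuous_powerBarrier hρ1
    rw [fracInt_sub hb hs.le hGhd.continuous.continuousOn (by fun_prop),
      fracInt_sub hb hs.le (by fun_prop) (by fun_prop), fracInt_const_mul, fracInt_const_mul]
  · intro t ht hut
    have ht0 : 0 < t := by linarith
    obtain ⟨hBt, hCt, -⟩ := hS t ht
    have hpr : 0 < M * t ^ (-r) := by positivity
    have hpρ : 0 < t ^ (-ρ) := by positivity
    have hεa : a * ε ≤ c / 2 := by rw [← hεc]; gcongr; linarith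
    have hεa' := mul_le_mul_of_nonneg_right hεa hpρ.le
    rcases hrel t (by linarith) with h | ⟨z, hz, h⟩
    · exfalso
      have := mul_lt_mul_of_pos_left (show M * t ^ (-r) - ε * t ^ (-ρ) < v t by linarith) ha
      have : 0 < a * (M * t ^ (-r)) := by positivity
      have : 0 < c / 2 * t ^ (-ρ) := by positivity
      nlinarith
    · refine ⟨z - R' t - (M * N₁' t - ε * N₂' t), ?_,
        (hz.fun_sub (hR t (by linarith)).2).fun_sub
          (((hN₁ t ht0).2.1.const_mul M).fun_sub ((hN₂ t ht0).2.1.const_mul ε))⟩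
      have e1 := mul_lt_mul_of_pos_left (show M * t ^ (-r) - ε * t ^ (-ρ) < v t by linarith) ha
      have e2 := (abs_le.1 (hRC t (by linarith))).1
      have e3 := (abs_le.1 (hN₁ t ht0).2.2).1
      have e4 := (abs_le.1 (hN₂ t ht0).2.2).2
      have e5 : B₁ * t ^ (1 - κ - 1 - r) ≤ a * t ^ (-r) := by
        rw [show 1 - κ - 1 - r = -κ + -r by ring, Real.rpow_add ht0, ← mul_assoc]
        exact mul_le_mul_of_nonneg_right hBt (by positivity)
      have e6 : B₂ * t ^ (1 - κ - 1 - ρ) ≤ B₂ * t ^ (-ρ) :=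
        mul_le_mul_of_nonneg_left
          (Real.rpow_le_rpow_of_exponent_le (by linarith) (by linarith)) hB₂
      have e7 := mul_le_mul_of_nonneg_left (show -(a * t ^ (-r)) ≤ N₁' t by linarith) hM.le
      have e8 := mul_le_mul_of_nonneg_left (e4.trans e6) hε0.le
      have e9 : (a + B₂) * ε * t ^ (-ρ) = c / 2 * t ^ (-ρ) := by rw [hεc]
      linarith

end Comparison

section Contradiction

open scoped Topology

lemma exists_le_neg_rpow_of_deriv_le {p ε : ℝ} (hp : -1 < p) (hε : 0 < ε) {F F' : ℝ → ℝ}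
    (h : ∀ᶠ t in atTop, HasDerivAt F (F' t) t ∧ F' t ≤ -(ε * t ^ p)) :
    ∃ ε' > 0, ∀ᶠ t in atTop, F t ≤ -(ε' * t ^ (p + 1)) := by
  obtain ⟨S, hS⟩ := eventually_atTop.1 (h.and (eventually_ge_atTop 1))
  have hp1 : 0 < p + 1 := by linarith
  set k := ε / (p + 1)
  have hk : 0 < k := by positivity
  have hkp : k * (p + 1) = ε := by simp only [k]; field_simp
  set E := fun t => F t + k * t ^ (p + 1)
  have hE : ∀ t ≥ S, HasDerivAt E (F' t + ε * t ^ p) t := by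
    intro t ht
    have h1 := (Real.hasDerivAt_rpow_const (x := t) (p := p + 1)
      (Or.inl (by linarith [(hS t ht).2]))).const_mul k
    rw [← mul_assoc, hkp, add_sub_cancel_right] at h1
    exact (hS t ht).1.1.fun_add h1
  have hanti : AntitoneOn E (Ici S) := by
    refine antitoneOn_of_deriv_nonpos (convex_Ici S)
      (fun t ht => (hE t ht).continuousAt.continuousWithinAt)
      (fun t ht => (hE t (interior_subset ht)).differentiableAt.differentiableWithinAt) ?_
    intro t ht
    have ht' := interior_subset ht
    rw [(hE t ht').deriv]
    linarith [(hS t ht').1.2]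
  refine ⟨k / 2, by positivity, ?_⟩
  filter_upwards [eventually_ge_atTop S,
    (tendsto_rpow_atTop hp1).eventually_ge_atTop (E S / (k / 2))] with t ht htE
  have h1 : F t + k * t ^ (p + 1) ≤ E S := hanti self_mem_Ici ht ht
  rw [div_le_iff₀ (by positivity)] at htE
  linarith

/-- If the `m`-th derivative of `Y` has a fractional integral whose derivative is at most
`-ε t ^ (-ρ)`, then `Y` cannot be bounded below by a polynomial of degree `m`. -/
theorem false_of_fracInt_deriv_le {γ ρ ε C : ℝ} {m : ℕ} (hγ : 0 < γ) (hρ : 0 < ρ)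
    (hγρ : γ + ρ < 1) (hε : 0 < ε) {Y v : ℝ → ℝ} (hY : ContDiff ℝ m Y)
    (hY0 : ∀ j, ∀ s ≤ 0, iteratedDeriv j Y s = 0)
    (hlow : ∀ s ≥ 0, -(C * (1 + s) ^ m) ≤ Y s)
    (hv : ∀ᶠ t in atTop, HasDerivAt (fracInt γ (iteratedDeriv m Y)) (v t) t ∧
      v t ≤ -(ε * t ^ (-ρ))) : False := by
  have hstep : ∀ j ≤ m, ∃ ε > 0, ∀ᶠ t in atTop,
      fracInt γ (iteratedDeriv (m - j) Y) t ≤ -(ε * t ^ ((j : ℝ) - ρ + 1)) := by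
    intro j
    induction j with
    | zero =>
      intro _
      simpa using exists_le_neg_rpow_of_deriv_le (by linarith) hε hv
    | succ j ih =>
      intro hj
      obtain ⟨ε, hε, h⟩ := ih (by omega)
      have hmj : m - j = m - (j + 1) + 1 := by omega
      have hj0 : (0 : ℝ) ≤ j := j.cast_nonneg
      obtain ⟨ε', hε', h'⟩ := exists_le_neg_rpow_of_deriv_le (p := (j : ℝ) - ρ + 1) (by linarith)
        hε (F := fracInt γ (iteratedDeriv (m - (j + 1)) Y))
        (h.mono fun t ht => ⟨hasDerivAt_fracInt hγ
          (fun s => hasDerivAt_iteratedDeriv hY (by omega) s)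
          (hY.continuous_iteratedDeriv _ (by exact_mod_cast (by omega))) (hY0 _) (hY0 _) t,
          by rwa [← hmj]⟩)
      refine ⟨ε', hε', ?_⟩
      have e : ((j + 1 : ℕ) : ℝ) - ρ + 1 = (j : ℝ) - ρ + 1 + 1 := by
        push_cast
        ring
      rwa [e]
  obtain ⟨ε', hε', hup⟩ := hstep m le_rfl
  rw [Nat.sub_self] at hup
  set K := |C| * 2 ^ m * (1 / (γ * Real.Gamma γ))
  have hlim : Tendsto (fun t : ℝ => t ^ (1 - ρ - γ)) atTop atTop :=
    tendsto_rpow_atTop (by linarith)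
  obtain ⟨t, h1, ht1, h2⟩ := (hup.and ((eventually_ge_atTop 1).and
    (hlim.eventually_gt_atTop (K / ε')))).exists
  have ht0 : 0 < t := by linarith
  have h3 : fracInt γ (fun _ => -(|C| * (2 * t) ^ m)) t ≤ fracInt γ Y t := by
    refine fracInt_mono hγ ht0.le continuousOn_const hY.continuous.continuousOn fun s hs => ?_
    refine le_trans (neg_le_neg ?_) (hlow s hs.1)
    have : (1 + s) ^ m ≤ (2 * t) ^ m :=
      pow_le_pow_left₀ (by linarith [hs.1]) (by linarith [hs.2]) m
    have hp : 0 ≤ (1 + s) ^ m := pow_nonneg (by linarith [hs.1]) m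
    calc C * (1 + s) ^ m ≤ |C| * (1 + s) ^ m := mul_le_mul_of_nonneg_right (le_abs_self C) hp
      _ ≤ _ := mul_le_mul_of_nonneg_left this (abs_nonneg C)
  rw [fracInt_const hγ] at h3
  rw [iteratedDeriv_zero] at h1
  have h4 : -(|C| * (2 * t) ^ m) * (t ^ γ / (γ * Real.Gamma γ)) = -(K * t ^ ((m : ℝ) + γ)) := by
    rw [Real.rpow_add ht0, Real.rpow_natCast, mul_pow]
    simp only [K]
    ring
  have h5 : t ^ ((m : ℝ) - ρ + 1) = t ^ (1 - ρ - γ) * t ^ ((m : ℝ) + γ) := by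
    rw [← Real.rpow_add ht0]
    ring_nf
  rw [div_lt_iff₀ hε'] at h2
  have h6 := mul_lt_mul_of_pos_right h2 (Real.rpow_pos_of_pos ht0 ((m : ℝ) + γ))
  rw [h4] at h3
  rw [h5] at h1
  linarith

lemma hasDerivAt_of_eq_deriv_add {F H : ℝ → ℝ} {D H' t : ℝ} (hH : HasDerivAt H H' t)
    (hD : D = deriv (fun s => F s + H s) t) (h : D ≠ 0 ∨ DifferentiableAt ℝ F t) :
    HasDerivAt F (D - H') t := by
  have hd : DifferentiableAt ℝ F t := by
    rcases h with h | h
    · have := (differentiableAt_of_deriv_ne_zero (hD ▸ h)).fun_sub hH.differentiableAt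
      simpa using this
    · exact h
  rw [hD, (hd.hasDerivAt.fun_add hH).deriv, add_sub_cancel_right]
  exact hd.hasDerivAt

/-- A function bounded below by a polynomial of degree `m` whose Riemann–Liouville derivatives of
orders `β < α` satisfy `D^α y + a D^β y ≤ -c t ^ (-ρ)` eventually does not exist. -/
theorem false_of_rlDeriv_add_le {m : ℕ} {α β a c C ρ T : ℝ} (hβα : β < α)
    (hα : α ≤ m + 1) (ha : 0 < a) (hc : 0 < c) (hρ : 0 < ρ) (hσ : m + 1 - β + ρ < 1)
    (hT : 0 < T) {y h : ℝ → ℝ} (hy : ContDiffOn ℝ m y (Ici 0))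
    (hlow : ∀ t ≥ T, -(C * (1 + t) ^ m) ≤ y t)
    (hDα : ContinuousOn (iteratedDeriv (m + 1) (fracInt (m + 1 - α) y)) (Ioi T))
    (heq : ∀ t > T, iteratedDeriv (m + 1) (fracInt (m + 1 - α) y) t
      + a * iteratedDeriv (m + 1) (fracInt (m + 1 - β) y) t = h t)
    (hh : ContinuousOn h (Ioi T)) (hle : ∀ t > T, h t ≤ -(c * t ^ (-ρ))) : False := by
  set γ := (m : ℝ) + 1 - β with hγdef
  set Dα := iteratedDeriv (m + 1) (fracInt (m + 1 - α) y)
  set Dβ := iteratedDeriv (m + 1) (fracInt γ y)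
  have hγ : 0 < γ := by linarith
  have hρ1 : ρ < 1 := by linarith
  have hY := contDiff_switchOn hT hy
  have hY0 : ∀ j, ∀ s ≤ 0, iteratedDeriv j (switchOn T y) s = 0 := fun j s hs =>
    iteratedDeriv_switchOn_of_lt y j (by linarith)
  have hYlow : ∀ s ≥ 0, -(|C| * (1 + s) ^ m) ≤ switchOn T y s := by
    intro s hs
    have hp : 0 ≤ |C| * (1 + s) ^ m := by positivity
    rcases le_total s T with hsT | hsT
    · rw [switchOn_of_le y hsT]
      linarith
    · have h1 : -(|C| * (1 + s) ^ m) ≤ y s := by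
        have : C * (1 + s) ^ m ≤ |C| * (1 + s) ^ m :=
          mul_le_mul_of_nonneg_right (le_abs_self C) (by positivity)
        linarith [hlow s hsT]
      have h2 := mul_le_mul_of_nonneg_left h1 (Real.smoothTransition.nonneg (s - T))
      have h3 := mul_le_mul_of_nonneg_right (Real.smoothTransition.le_one (s - T)) hp
      unfold switchOn
      linarith
  set w := iteratedDeriv m (switchOn T y)
  have hw : Continuous w := hY.continuous_iteratedDeriv m le_rfl
  obtain ⟨Hβ, Hβ', hHβ, hHβc, ⟨Cβ, hCβ, hHβb⟩, hDβ⟩ :=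
    exists_iteratedDeriv_fracInt_eq_deriv hγ (by linarith) hT hy
  suffices hmain : ∃ ε > 0, ∃ v : ℝ → ℝ, ∀ᶠ t in atTop, HasDerivAt (fracInt γ w) (v t) t ∧
      v t ≤ -(ε * t ^ (-ρ)) by
    obtain ⟨ε, hε, v, hv⟩ := hmain
    exact false_of_fracInt_deriv_le hγ hρ hσ hε hY hY0 hYlow hv
  have hneg : ∀ t > T, h t < 0 := fun t ht => by
    have : 0 < t := hT.trans ht
    have : 0 < c * t ^ (-ρ) := by positivity
    linarith [hle t ht]
  have hβne : ∀ t > T, Dα t = 0 → Dβ t ≠ 0 := fun t ht h0 h0' => by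
    have := heq t ht
    rw [h0, h0'] at this
    linarith [hneg t ht]
  have hone : ∀ t > T + 1, Dα t = 0 → HasDerivAt (fracInt γ w) (Dβ t - Hβ' t) t :=
    fun t ht h0 => hasDerivAt_of_eq_deriv_add (hHβ t ht) (hDβ t ht)
      (Or.inl (hβne t (by linarith) h0))
  rcases hα.eq_or_lt with hαe | hαlt
  · have hDα0 : ∀ t, Dα t = 0 := by
      intro t
      have : fracInt ((m : ℝ) + 1 - α) y = fun _ => 0 := by
        ext s
        simp [fracInt, hαe]
      simp only [Dα, this]
      simp
    refine ⟨c / 2 / a, by positivity, fun t => Dβ t - Hβ' t, ?_⟩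
    filter_upwards [eventually_gt_atTop (T + 1), eventually_ge_atTop (2 * T + 4),
      eventually_div_lt_rpow_neg hρ1 (half_pos hc) (a * Cβ)] with t ht ht' htC
    refine ⟨hone t ht (hDα0 t), ?_⟩
    have h1 := heq t (by linarith)
    rw [hDα0, zero_add] at h1
    have h2 := mul_le_mul_of_nonneg_left (abs_le.1 (hHβb t ht')).1 ha.le
    rw [mul_neg, ← mul_div_assoc] at h2
    have h3 : a * (Dβ t - Hβ' t) ≤ -(c / 2 * t ^ (-ρ)) := by
      linarith [hle t (by linarith)]
    rw [div_mul_eq_mul_div, ← neg_div, le_div_iff₀ ha]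
    linarith
  · have hδ : 0 < (m : ℝ) + 1 - α := by linarith
    obtain ⟨Hα, Hα', hHα, hHαc, ⟨Cα, hCα, hHαb⟩, hDα'⟩ :=
      exists_iteratedDeriv_fracInt_eq_deriv hδ (by linarith) hT hy
    have hκ0 : 0 < α - β := by linarith
    set G := fracInt ((m : ℝ) + 1 - α) w
    have hG : Continuous G := continuous_fracInt hδ hw (hY0 m)
    have hG0 : ∀ s ≤ 0, G s = 0 := fun s hs => fracInt_of_nonpos (hY0 m) hs
    have hGβ : fracInt (α - β) G = fracInt γ w := by
      ext t
      rw [fracInt_fracInt hκ0 hδ hw (hY0 m),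
        show α - β + ((m : ℝ) + 1 - α) = γ by rw [hγdef]; ring]
    have hGd : ∀ t > T + 1, Dα t ≠ 0 → HasDerivAt G (Dα t - Hα' t) t := fun t ht h0 =>
      hasDerivAt_of_eq_deriv_add (hHα t ht) (hDα' t ht) (Or.inl h0)
    have hDα1 : ContinuousOn Dα (Ioi (T + 1)) := hDα.mono (Ioi_subset_Ioi (by linarith))
    have hv : ∀ t > T + 1, HasDerivAt (fracInt (α - β) G) (Dβ t - Hβ' t) t := by
      intro t ht
      rw [hGβ]
      by_cases h0 : Dα t = 0
      · exact hone t ht h0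
      · refine hasDerivAt_of_eq_deriv_add (hHβ t ht) (hDβ t ht) (Or.inr ?_)
        rw [← hGβ]
        have hopen : IsOpen (Ioi (T + 1) ∩ Dα ⁻¹' {0}ᶜ) :=
          hDα1.isOpen_inter_preimage isOpen_Ioi isOpen_compl_singleton
        have hcd := contDiffOn_one_of_hasDerivAt hopen (fun s hs => hGd s hs.1 hs.2)
          ((hDα1.sub hHαc).mono inter_subset_left)
        refine differentiableAt_fracInt hκ0 (by linarith) hG ?_
        filter_upwards [hopen.mem_nhds ⟨ht, h0⟩] with s hs
        exact hcd.contDiffAt (hopen.mem_nhds hs)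
    obtain ⟨S, hS⟩ := eventually_atTop.1 ((eventually_div_lt_rpow_neg hρ1 (half_pos hc)
      (Cα + a * Cβ)).and (eventually_ge_atTop (2 * T + 4)))
    have hST : 2 * T + 4 ≤ S := (hS S le_rfl).2
    have hvc : ContinuousOn (fun t => Dβ t - Hβ' t) (Ici S) := by
      have hsub : Ici S ⊆ Ioi (T + 1) := fun t ht => by
        simp only [mem_Ici, mem_Ioi] at *
        linarith
      refine ContinuousOn.sub ?_ (hHβc.mono hsub)
      have hq : ContinuousOn (fun t => (h t - Dα t) / a) (Ici S) :=
        (((hh.sub hDα).mono (Ioi_subset_Ioi (by linarith))).mono hsub).div_const a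
      refine hq.congr fun t ht => ?_
      have := heq t (by have := hsub ht; simp only [mem_Ioi] at this; linarith)
      rw [eq_div_iff ha.ne']
      linarith
    obtain ⟨ε, hε, hev⟩ := exists_le_neg_rpow_of_fracRelaxation hκ0 (by linarith) ha
      (half_pos hc) hρ hρ1 (show 0 < S by linarith) hG hG0 (fun t ht => hv t (by linarith)) hvc
      (by
        intro t ht
        obtain ⟨hC, -⟩ := hS t ht
        have ht0 : 0 < t := by linarith
        have h1 := heq t (by linarith)
        have h2 := hle t (by linarith)
        have h3 := mul_le_mul_of_nonneg_left (abs_le.1 (hHβb t (by linarith))).1 ha.le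
        have h4 := (abs_le.1 (hHαb t (by linarith))).1
        have h5 : 0 ≤ Cα / t := by positivity
        rw [mul_neg, ← mul_div_assoc] at h3
        rw [add_div] at hC
        by_cases h0 : Dα t = 0
        · left
          rw [h0] at h1
          linarith
        · right
          exact ⟨_, hGd t (by linarith) h0, by linarith⟩)
    refine ⟨ε, hε, fun t => Dβ t - Hβ' t, ?_⟩
    filter_upwards [hev, eventually_gt_atTop (T + 1)] with t h1 h2
    exact ⟨hGβ ▸ hv t h2, h1⟩

end Contradiction

section NonOscillatory

lemma contDiff_taylorPolyAt0 (n m : ℕ) (x : ℝ → ℝ) : ContDiff ℝ m (taylorPolyAt0 n x) := by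
  unfold taylorPolyAt0
  fun_prop

lemma exists_abs_taylorPolyAt0_le (m : ℕ) (x : ℝ → ℝ) :
    ∃ C, ∀ t ≥ 0, |taylorPolyAt0 (m + 1) x t| ≤ C * (1 + t) ^ m := by
  refine ⟨∑ k ∈ Finset.range (m + 1), |iteratedDeriv k x 0 / (Nat.factorial k : ℝ)|,
    fun t ht => ?_⟩
  rw [Finset.sum_mul]
  refine (Finset.abs_sum_le_sum_abs _ _).trans (Finset.sum_le_sum fun k hk => ?_)
  rw [abs_mul, abs_of_nonneg (pow_nonneg ht k)]
  refine mul_le_mul_of_nonneg_left ?_ (abs_nonneg _)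
  calc t ^ k ≤ (1 + t) ^ k := pow_le_pow_left₀ ht (by linarith) k
    _ ≤ _ := pow_le_pow_right₀ (by linarith) (Finset.mem_range_succ_iff.1 hk)

lemma exists_eventually_sign_of_not_oscillatory {x : ℝ → ℝ} (hx : ContinuousOn x (Ici 0))
    (h : ¬ Oscillatory x) : ∃ s T : ℝ, s * s = 1 ∧ 0 < T ∧ ∀ t ≥ T, 0 < s * x t := by
  obtain ⟨T, hT, hne⟩ : ∃ T > 0, ∀ t ≥ T, x t ≠ 0 := by
    by_contra! hcon
    choose u hu hu0 using fun k : ℕ => hcon ((k : ℝ) + 1) (by positivity)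
    refine h ⟨u, fun k => (by positivity : (0 : ℝ) ≤ (k : ℝ) + 1).trans (hu k), ?_, hu0⟩
    exact tendsto_atTop_mono (fun k => by linarith [hu k]) tendsto_natCast_atTop_atTop
  have hxT : ContinuousOn x (Ici T) := hx.mono (Ici_subset_Ici.2 hT.le)
  refine ⟨SignType.sign (x T), T, ?_, hT, fun t ht => ?_⟩
  · rcases lt_or_gt_of_ne (hne T le_rfl) with h0 | h0 <;> simp [h0]
  · rcases lt_or_gt_of_ne (hne T le_rfl) with h0 | h0
    · simp only [sign_neg h0, SignType.coe_neg_one, neg_one_mul, Left.neg_pos_iff]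
      by_contra! hge
      obtain ⟨r, hr, hr0⟩ := isPreconnected_Ici.intermediate_value self_mem_Ici ht hxT
        ⟨h0.le, hge⟩
      exact hne r hr hr0
    · simp only [sign_pos h0, SignType.coe_one, one_mul]
      by_contra! hle
      obtain ⟨r, hr, hr0⟩ := isPreconnected_Ici.intermediate_value ht self_mem_Ici hxT
        ⟨hle, h0.le⟩
      exact hne r hr hr0

lemma mul_sign_of_mul_pos {s x : ℝ} (hs : s * s = 1) (h : 0 < s * x) : s * Real.sign x = 1 := by
  rcases mul_self_eq_one_iff.1 hs with rfl | rfl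
  · rw [Real.sign_of_pos (by linarith), mul_one]
  · rw [Real.sign_of_neg (by linarith)]
    norm_num

lemma iteratedDeriv_fracInt_const_mul (k : ℕ) (b s : ℝ) (y : ℝ → ℝ) (t : ℝ) :
    iteratedDeriv k (fracInt b fun r => s * y r) t = s * iteratedDeriv k (fracInt b y) t := by
  have : (fracInt b fun r => s * y r) = fun t => s * fracInt b y t :=
    funext fun t => fracInt_const_mul b s y t
  rw [this, iteratedDeriv_const_mul_field]

lemma caputoD_eq {m : ℕ} {α : ℝ} (h : ⌈α⌉₊ = m + 1) (x : ℝ → ℝ) :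
    caputoD α x = iteratedDeriv (m + 1)
      (fracInt (m + 1 - α) fun s => x s - taylorPolyAt0 (m + 1) x s) := by
  unfold caputoD
  rw [h]
  push_cast
  rfl

/-- The damped fractional equation with a forcing term of size `t ^ (-ρ)`, where
`⌈β⌉₊ - β + ρ < 1`, has no non-oscillatory solution. -/
theorem oscillatory_of_caputoD_add_eq {m : ℕ} {α β a c ρ T₀ : ℝ} (hα : ⌈α⌉₊ = m + 1)
    (hβ : ⌈β⌉₊ = m + 1) (hβα : β < α) (ha : 0 < a) (hc : 0 < c) (hρ : 0 < ρ)
    (hσ : m + 1 - β + ρ < 1) {f q g x : ℝ → ℝ} (hf : Continuous f)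
    (hq : ContinuousOn q (Ici 0)) (hg : ContinuousOn g (Ici 0)) (hf0 : ∀ u, u ≠ 0 → 0 < u * f u)
    (hq0 : ∀ t ≥ T₀, 0 ≤ q t) (hgc : ∀ t ≥ T₀, c * t ^ (-ρ) ≤ g t)
    (hx : ContCaputoDiffOnIci α x)
    (heq : ∀ t > 0, caputoD α x t + a * caputoD β x t + q t * f (x t)
      + Real.sign (x t) * g t = 0) : Oscillatory x := by
  by_contra hosc
  obtain ⟨hxd, hDα⟩ := hx
  rw [hα, Nat.add_sub_cancel] at hxd
  obtain ⟨s, T₁, hs, hT₁, hpos⟩ := exists_eventually_sign_of_not_oscillatory hxd.continuousOn hosc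
  obtain ⟨C, hC⟩ := exists_abs_taylorPolyAt0_le m x
  rw [caputoD_eq hα] at hDα heq
  rw [caputoD_eq hβ] at heq
  have hs1 : |s| = 1 := by rcases mul_self_eq_one_iff.1 hs with rfl | rfl <;> simp
  set y := fun r => x r - taylorPolyAt0 (m + 1) x r
  set T := max T₀ T₁
  have hT : 0 < T := hT₁.trans_le (le_max_right _ _)
  have hαle : α ≤ m + 1 := by exact_mod_cast hα ▸ Nat.le_ceil α
  have hsub : Ioi T ⊆ Ici 0 := fun t ht => hT.le.trans (le_of_lt ht)
  have hsf : ∀ t ≥ T, 0 < s * f (x t) := by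
    intro t ht
    have h1 := hpos t ((le_max_right _ _).trans ht)
    have h2 := hf0 (x t) (by rintro h0; simp [h0] at h1)
    have h3 : s * x t * (s * f (x t)) = x t * f (x t) := by
      linear_combination (x t * f (x t)) * hs
    exact pos_of_mul_pos_right (h3 ▸ h2) h1.le
  refine false_of_rlDeriv_add_le (y := fun r => s * y r) (C := C)
    (h := fun t => -(q t * (s * f (x t)) + g t)) hβα hαle ha hc hρ hσ hT ?_ ?_ ?_ ?_ ?_ ?_
  · exact contDiffOn_const.mul (hxd.sub (contDiff_taylorPolyAt0 _ _ x).contDiffOn)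
  · intro t ht
    have h1 := hpos t ((le_max_right _ _).trans ht)
    have h2 := hC t (hT.le.trans ht)
    have h3 : s * taylorPolyAt0 (m + 1) x t ≤ |taylorPolyAt0 (m + 1) x t| := by
      refine (le_abs_self _).trans ?_
      rw [abs_mul, hs1, one_mul]
    simp only [y]
    linarith
  · have : iteratedDeriv (m + 1) (fracInt (m + 1 - α) fun r => s * y r)
        = fun t => s * iteratedDeriv (m + 1) (fracInt (m + 1 - α) y) t :=
      funext fun t => iteratedDeriv_fracInt_const_mul _ _ _ _ _
    rw [this]
    exact continuousOn_const.mul (hDα.mono hsub)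
  · intro t ht
    rw [iteratedDeriv_fracInt_const_mul, iteratedDeriv_fracInt_const_mul]
    have h1 := mul_sign_of_mul_pos hs (hpos t ((le_max_right _ _).trans (le_of_lt ht)))
    linear_combination s * heq t (hT.trans ht) - g t * h1
  · exact (((hq.mono hsub).mul (continuousOn_const.mul
      (hf.comp_continuousOn (hxd.continuousOn.mono hsub)))).add (hg.mono hsub)).neg
  · intro t ht
    have h0 := (le_max_left T₀ T₁).trans (le_of_lt ht)
    have := mul_nonneg (hq0 t h0) (hsf t (le_of_lt ht)).le
    linarith [hgc t h0]

end NonOscillatory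

/-- asymptotics of non-oscillatory solutions (even `n`). -/
theorem stmt12
    (n : ℕ) (hn3 : 3 ≤ n) (heven : Even n)
    (α β a : ℝ)
    (hβ : (n : ℝ) - 1 < β) (hβα : β < α) (hceil : ⌈α⌉₊ = n)
    (ha : 0 < a)
    (f : ℝ → ℝ) (q g : ℝ → ℝ)
    (hfc : Continuous f) (hqc : ContinuousOn q (Set.Ici 0))
    (hgc : ContinuousOn g (Set.Ici 0))
    (hG1 : ∀ u : ℝ, u ≠ 0 → 0 < u * f u)
    (hG2 : ∃ c₁ > (0:ℝ), ∃ η > (0:ℝ), ∀ u : ℝ, 1 ≤ |u| → c₁ * |u| ^ η ≤ |f u|)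
    (hG3 : ∃ c₂ > (0:ℝ), ∃ μ : ℝ, 0 < μ ∧ μ < ((n : ℝ) - 2) / ((n : ℝ) - β) ∧
      ∀ u : ℝ, |u| < 1 → c₂ * |u| ^ μ ≤ |f u|)
    (hH : ∃ T₁ > (0:ℝ), ∃ c₃ > (0:ℝ), ∀ t ≥ T₁, c₃ ≤ q t)
    (hK : ∃ σ : ℝ, (n : ℝ) - β < σ ∧ σ < 1 ∧
      ∃ c₄ > (0:ℝ), ∃ T₂ > (0:ℝ), ∀ t ≥ T₂, c₄ * t ^ ((n : ℝ) - β - σ) ≤ g t)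
    (ξ : ℕ → ℝ) (x : ℝ → ℝ)
    (hx : ContCaputoDiffOnIci α x)
    (heq : ∀ t > (0:ℝ),
      caputoD α x t + a * caputoD β x t + q t * f (x t) + Real.sign (x t) * g t = 0)
    (hinit : ∀ i < n, iteratedDeriv i x 0 = ξ i)
    (hnonosc : ¬ Oscillatory x) :
    ∃ M > (0:ℝ), ∃ T > (0:ℝ), ∀ t ≥ T, |x t| ≤ M * t ^ (α - n) := by
  exfalso
  obtain ⟨m, rfl⟩ : ∃ m, n = m + 1 := ⟨n - 1, by omega⟩
  obtain ⟨T₁, -, c₃, hc₃, hq⟩ := hH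
  obtain ⟨σ, hσ, hσ1, c₄, hc₄, T₂, -, hg⟩ := hK
  have hα : α ≤ (m + 1 : ℕ) := hceil ▸ Nat.le_ceil α
  have hβceil : ⌈β⌉₊ = m + 1 := by
    rw [Nat.ceil_eq_iff (by omega)]
    exact ⟨by push_cast at hβ ⊢; simpa using hβ, hβα.le.trans hα⟩
  push_cast at hσ hg
  refine hnonosc (oscillatory_of_caputoD_add_eq (T₀ := max T₁ T₂)
    (ρ := σ - (m + 1 - β)) hceil hβceil hβα ha hc₄ (by linarith) (by linarith) hfc hqc hgc hG1
    (fun t ht => hc₃.le.trans (hq t ((le_max_left _ _).trans ht))) (fun t ht => ?_) hx heq)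
  rw [neg_sub]
  exact hg t ((le_max_right _ _).trans ht)
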